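/- arXiv:math/0412483 — 4 statements merged into one kernel-verified Lean document; each statement's English description precedes it below -/
import Mathlib

section
/- Let d ≥ 1 and n = 2d. Let Γ ⊂ ℝ^n be the image of a continuous injective map from the circle S^1 such that every affine hyperplane of ℝ^n intersects Γ in at most n points (a simple closed convex curve), and let μ be a finite Borel measure on ℝ^n concentrated on Γ such that every nonempty relatively open arc of Γ has positive μ-measure. If there exist n hyperplanes H_1,…,H_n in ℝ^n forming an equipartition of μ, then 2^n ≤ n^2; in particular n ≤ 4. -/
open MeasureTheory RealInnerProductSpace

/-- The closed half-space of `ℝ^n` bounded by the hyperplane with normal vector `a` and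
constant `c`. -/
def closedHalfspace {n : ℕ} (a : EuclideanSpace ℝ (Fin n)) (c : ℝ) (ε : Bool) :
    Set (EuclideanSpace ℝ (Fin n)) :=
  if ε then {x | ⟪a, x⟫ ≤ c} else {x | c ≤ ⟪a, x⟫}

/-- The hyperplanes with normal vectors `a i` and constants `c i` form an equipartition of
the measure `μ` on `ℝ^n`: every closed orthant has measure `μ(ℝ^n)/2^n`. -/
def IsEquipartition {n : ℕ} (μ : Measure (EuclideanSpace ℝ (Fin n)))
    (a : Fin n → EuclideanSpace ℝ (Fin n)) (c : Fin n → ℝ) : Prop :=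
  ∀ ε : Fin n → Bool, μ (⋂ i, closedHalfspace (a i) (c i) (ε i)) = μ Set.univ / 2 ^ n

/-- If finitely many continuous functions on the circle have finitely many zeros in total,
at least one, then the number of their sign patterns at points other than these zeros is at most
the number of zeros. -/
theorem card_le_ncard_zeros_of_sign_patterns_ne {ι κ : Type*} [Finite κ] (f : ι → Circle → ℝ)
    (hf : ∀ i, Continuous (f i)) (hZ : {z | ∃ i, f i z = 0}.Finite)
    (hne : {z | ∃ i, f i z = 0}.Nonempty) (z : κ → Circle) (hz : ∀ k i, f i (z k) ≠ 0)
    (hsep : ∀ k l, k ≠ l → ∃ i, f i (z k) * f i (z l) < 0) :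
    Nat.card κ ≤ {z | ∃ i, f i z = 0}.ncard := by
  set Z := {z | ∃ i, f i z = 0}
  obtain ⟨p, hp⟩ := hne
  obtain ⟨θ, rfl⟩ : ∃ θ : ℝ, Circle.exp θ = p := ⟨_, Circle.exp_arg p⟩
  let T := {t ∈ Set.Ioc θ (θ + 2 * Real.pi) | Circle.exp t ∈ Z}
  have hinj : Set.InjOn Circle.exp T := by
    intro s hs t ht hst
    obtain ⟨m, hm⟩ := Circle.exp_eq_exp.1 hst
    have hπ := Real.pi_pos
    have h1 := hs.1.1
    have h2 := hs.1.2
    have h3 := ht.1.1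
    have h4 := ht.1.2
    have hm1 : (m : ℝ) < 1 := by
      by_contra! h
      nlinarith
    have hm2 : (-1 : ℝ) < m := by
      by_contra! h
      nlinarith
    have hm0 : m = 0 := by
      have : m < 1 := by exact_mod_cast hm1
      have : -1 < m := by exact_mod_cast hm2
      omega
    simpa [hm0] using hm
  have hmaps : Set.MapsTo Circle.exp T Z := fun t ht => ht.2
  have hTfin : T.Finite := Set.Finite.of_injOn hmaps hinj hZ
  have hend : θ + 2 * Real.pi ∈ T := by
    refine ⟨⟨by linarith [Real.pi_pos], le_rfl⟩, ?_⟩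
    rwa [Circle.periodic_exp θ]
  have hlift (k : κ) : ∃ t ∈ Set.Ioc θ (θ + 2 * Real.pi), z k = Circle.exp t := by
    obtain ⟨t, ht, h⟩ := Circle.periodic_exp.exists_mem_Ioc Real.two_pi_pos (z k).val.arg θ
    exact ⟨t, ht, by rw [← h, Circle.exp_arg]⟩
  choose t ht hzt using hlift
  have hnext (k : κ) : ∃ u ∈ T, t k ≤ u ∧ ∀ v ∈ T, t k ≤ v → u ≤ v := by
    obtain ⟨u, hu, hmin⟩ := Set.exists_min_image {u ∈ T | t k ≤ u} id
      (hTfin.subset (Set.sep_subset _ _)) ⟨_, hend, (ht k).2⟩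
    exact ⟨u, hu.1, hu.2, fun v hv hkv => hmin v ⟨hv, hkv⟩⟩
  choose u huT htu hmin using hnext
  have key (k l : κ) (hle : t k ≤ t l) (hu : u k = u l) : k = l := by
    by_contra hkl
    obtain ⟨i, hi⟩ := hsep k l hkl
    have hcont : ContinuousOn (fun s => f i (Circle.exp s)) (Set.uIcc (t k) (t l)) :=
      ((hf i).comp Circle.exp.continuous).continuousOn
    have h0 : (0 : ℝ) ∈ Set.uIcc (f i (Circle.exp (t k))) (f i (Circle.exp (t l))) := by
      rw [← hzt, ← hzt, Set.mem_uIcc]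
      rcases mul_neg_iff.1 hi with h | h
      · exact Or.inr ⟨h.2.le, h.1.le⟩
      · exact Or.inl ⟨h.1.le, h.2.le⟩
    obtain ⟨s, hs, hs0⟩ := intermediate_value_uIcc hcont h0
    rw [Set.uIcc_of_le hle] at hs
    have hsT : s ∈ T := ⟨⟨(ht k).1.trans_le hs.1, hs.2.trans (ht l).2⟩, i, hs0⟩
    have hsl : s = t l := le_antisymm hs.2 ((htu l).trans (hu ▸ hmin k s hsT hs.1))
    exact hz l i (by rw [hzt, ← hsl]; exact hs0)
  have huinj : Function.Injective u := fun k l h =>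
    (le_total (t k) (t l)).elim (fun hle => key k l hle h) (fun hle => (key l k hle h.symm).symm)
  calc Nat.card κ = (Set.range u).ncard := by
        rw [← Nat.card_coe_set_eq, Nat.card_range_of_injective huinj]
    _ ≤ T.ncard := Set.ncard_le_ncard (Set.range_subset_iff.2 huT) hTfin
    _ ≤ Z.ncard := Set.ncard_le_ncard_of_injOn _ hmaps hinj hZ

theorem mem_closedHalfspace_iff {n : ℕ} {a x : EuclideanSpace ℝ (Fin n)} {c : ℝ} {ε : Bool} :
    x ∈ closedHalfspace a c ε ↔ if ε then ⟪a, x⟫ ≤ c else c ≤ ⟪a, x⟫ := by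
  cases ε <;> simp [closedHalfspace]

theorem isClosed_closedHalfspace {n : ℕ} (a : EuclideanSpace ℝ (Fin n)) (c : ℝ) (ε : Bool) :
    IsClosed (closedHalfspace a c ε) := by
  cases ε
  · exact isClosed_le continuous_const (by fun_prop)
  · exact isClosed_le (by fun_prop) continuous_const

/-- The hyperplanes of an equipartition are null sets. -/
theorem IsEquipartition.measure_hyperplane_eq_zero {n : ℕ}
    {μ : Measure (EuclideanSpace ℝ (Fin n))} [IsFiniteMeasure μ]
    {a : Fin n → EuclideanSpace ℝ (Fin n)} {c : Fin n → ℝ} (h : IsEquipartition μ a c)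
    (j : Fin n) : μ {x | ⟪a j, x⟫ = c j} = 0 := by
  classical
  let O : (Fin n → Bool) → Set (EuclideanSpace ℝ (Fin n)) :=
    fun ε => ⋂ i, closedHalfspace (a i) (c i) (ε i)
  have hOmeas (ε) : MeasurableSet (O ε) :=
    (isClosed_iInter fun i => isClosed_closedHalfspace _ _ _).measurableSet
  set H := {x | ⟪a j, x⟫ = c j}
  have hHmeas : MeasurableSet H :=
    (isClosed_eq (by fun_prop) continuous_const).measurableSet
  have hsum : ∑ ε, μ (O ε) = μ Set.univ := by
    have hε (ε) : μ (O ε) = μ Set.univ / 2 ^ n := h ε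
    simp only [hε, Finset.sum_const, Finset.card_univ, Fintype.card_pi, Fintype.card_bool,
      Finset.prod_const, Fintype.card_fin, nsmul_eq_mul, Nat.cast_pow, Nat.cast_ofNat]
    exact ENNReal.mul_div_cancel (by simp) (by simp)
  have hpt (x) : 1 + H.indicator 1 x ≤
      ∑ ε, (O ε).indicator (1 : EuclideanSpace ℝ (Fin n) → ENNReal) x := by
    let ε₀ : Fin n → Bool := fun i => decide (⟪a i, x⟫ ≤ c i)
    have h₀ : x ∈ O ε₀ := Set.mem_iInter.2 fun i => by
      rw [mem_closedHalfspace_iff]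
      by_cases hi : ⟪a i, x⟫ ≤ c i
      · simp [ε₀, hi]
      · simp [ε₀, hi, (not_le.1 hi).le]
    by_cases hx : x ∈ H
    · have hx' : ⟪a j, x⟫ = c j := hx
      let ε₁ := Function.update ε₀ j false
      have h₁ : x ∈ O ε₁ := Set.mem_iInter.2 fun i => by
        by_cases hij : i = j
        · subst hij
          simp [ε₁, mem_closedHalfspace_iff, hx']
        · simpa [ε₁, hij] using Set.mem_iInter.1 h₀ i
      have hne : ε₀ ≠ ε₁ := fun he => by
        have := congrFun he j
        simp [ε₀, ε₁, hx'] at this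
      calc 1 + H.indicator 1 x
        _ = ∑ ε ∈ {ε₀, ε₁}, (O ε).indicator (1 : EuclideanSpace ℝ (Fin n) → ENNReal) x := by
            rw [Finset.sum_pair hne]
            simp [hx, h₀, h₁]
        _ ≤ _ := Finset.sum_le_sum_of_subset (Finset.subset_univ _)
    · calc 1 + H.indicator 1 x
        _ = (O ε₀).indicator (1 : EuclideanSpace ℝ (Fin n) → ENNReal) x := by
            simp [hx, h₀]
        _ ≤ _ := Finset.single_le_sum
            (f := fun ε => (O ε).indicator (1 : EuclideanSpace ℝ (Fin n) → ENNReal) x)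
            (fun _ _ => zero_le) (Finset.mem_univ ε₀)
  have hle : μ Set.univ + μ H ≤ μ Set.univ + 0 := by
    calc μ Set.univ + μ H = ∫⁻ x, (1 + H.indicator 1 x) ∂μ := by
          rw [lintegral_add_left measurable_const, lintegral_indicator_one hHmeas, lintegral_one]
      _ ≤ ∫⁻ x, ∑ ε, (O ε).indicator (1 : EuclideanSpace ℝ (Fin n) → ENNReal) x ∂μ :=
          lintegral_mono hpt
      _ = ∑ ε, μ (O ε) := by
          rw [lintegral_finsetSum _ fun ε _ => measurable_one.indicator (hOmeas ε)]
          exact Finset.sum_congr rfl fun ε _ => lintegral_indicator_one (hOmeas ε)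
      _ = μ Set.univ + 0 := by rw [hsum, add_zero]
  exact le_antisymm ((ENNReal.add_le_add_iff_left (measure_ne_top μ _)).1 hle) zero_le

/-- Every open orthant of an equipartition of a nonzero measure meets any set of full measure. -/
theorem IsEquipartition.exists_mem_open_orthant {n : ℕ}
    {μ : Measure (EuclideanSpace ℝ (Fin n))} [IsFiniteMeasure μ]
    {a : Fin n → EuclideanSpace ℝ (Fin n)} {c : Fin n → ℝ} (h : IsEquipartition μ a c)
    (hμ : μ ≠ 0) {s : Set (EuclideanSpace ℝ (Fin n))} (hs : μ sᶜ = 0) (ε : Fin n → Bool) :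
    ∃ x ∈ s, ∀ i, if ε i then ⟪a i, x⟫ < c i else c i < ⟪a i, x⟫ := by
  have hO : μ (⋂ i, closedHalfspace (a i) (c i) (ε i)) ≠ 0 := by
    rw [h ε]
    exact (ENNReal.div_pos (by simpa using hμ) (by simp)).ne'
  have hnull : μ (sᶜ ∪ ⋃ i, {x | ⟪a i, x⟫ = c i}) = 0 :=
    measure_union_null hs (measure_iUnion_null fun i => h.measure_hyperplane_eq_zero i)
  obtain ⟨x, hxO, hx⟩ : ∃ x ∈ ⋂ i, closedHalfspace (a i) (c i) (ε i),
      x ∉ sᶜ ∪ ⋃ i, {x | ⟪a i, x⟫ = c i} := by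
    by_contra! hsub
    exact hO (measure_mono_null hsub hnull)
  simp only [Set.mem_union, Set.mem_compl_iff, Set.mem_iUnion, Set.mem_ofPred_eq, not_or, not_not,
    not_exists] at hx
  refine ⟨x, hx.1, fun i => ?_⟩
  have hi := mem_closedHalfspace_iff.1 (Set.mem_iInter.1 hxO i)
  split_ifs at hi ⊢
  · exact lt_of_le_of_ne hi (hx.2 i)
  · exact lt_of_le_of_ne hi (Ne.symm (hx.2 i))

theorem sq_two_mul_lt_two_pow {d : ℕ} (hd : 3 ≤ d) : (2 * d) ^ 2 < 2 ^ (2 * d) := by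
  induction d, hd using Nat.le_induction with
  | base => norm_num
  | succ d hd ih =>
    rw [show 2 ^ (2 * (d + 1)) = 4 * 2 ^ (2 * d) by ring]
    nlinarith

/-- If a measure concentrated on a simple closed convex curve `Γ ⊂ ℝ^n` (`n = 2d` even),
charging every nonempty relatively open subset of `Γ`, admits an equipartition by `n`
hyperplanes, then `2^n ≤ n^2`; in particular `n ≤ 4`. -/
theorem equipartition_on_convex_curve_dim_le_four
    (d : ℕ) (hd : 1 ≤ d) (n : ℕ) (hn : n = 2 * d)
    (γ : Circle → EuclideanSpace ℝ (Fin n)) (hγc : Continuous γ)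
    (hγi : Function.Injective γ)
    (hconv : ∀ (a : EuclideanSpace ℝ (Fin n)) (e : ℝ), a ≠ 0 →
      (Set.range γ ∩ {x | ⟪a, x⟫ = e}).encard ≤ (n : ℕ∞))
    (μ : Measure (EuclideanSpace ℝ (Fin n))) [IsFiniteMeasure μ]
    (hconc : μ (Set.range γ)ᶜ = 0)
    (hpos : ∀ U : Set (EuclideanSpace ℝ (Fin n)), IsOpen U →
      (U ∩ Set.range γ).Nonempty → 0 < μ (U ∩ Set.range γ))
    (a : Fin n → EuclideanSpace ℝ (Fin n)) (c : Fin n → ℝ)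
    (ha : ∀ i, a i ≠ 0) (heq : IsEquipartition μ a c) :
    2 ^ n ≤ n ^ 2 ∧ n ≤ 4 := by
  have hμ : μ ≠ 0 := by
    rintro rfl
    simpa using hpos Set.univ isOpen_univ ⟨γ 1, Set.mem_univ _, 1, rfl⟩
  have hpts (ε : Fin n → Bool) :
      ∃ z : Circle, ∀ i, if ε i then ⟪a i, γ z⟫ < c i else c i < ⟪a i, γ z⟫ := by
    obtain ⟨_, ⟨z, rfl⟩, hz⟩ := heq.exists_mem_open_orthant hμ hconc ε
    exact ⟨z, hz⟩
  choose z hz using hpts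
  let f : Fin n → Circle → ℝ := fun i w => ⟪a i, γ w⟫ - c i
  have hf (i) : Continuous (f i) := by fun_prop
  have hzero (i : Fin n) : {w | f i w = 0}.encard ≤ n := by
    rw [← hγi.injOn.encard_image]
    refine (Set.encard_le_encard ?_).trans (hconv (a i) (c i) (ha i))
    rintro _ ⟨w, hw, rfl⟩
    exact ⟨⟨w, rfl⟩, sub_eq_zero.1 hw⟩
  have hfin (i : Fin n) : {w | f i w = 0}.Finite := Set.finite_of_encard_le_coe (hzero i)
  have hunion : {w | ∃ i, f i w = 0} = ⋃ i, {w | f i w = 0} := by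
    ext; simp
  have hZfin : {w | ∃ i, f i w = 0}.Finite := hunion ▸ Set.finite_iUnion hfin
  have hZcard : {w | ∃ i, f i w = 0}.ncard ≤ n ^ 2 := by
    rw [hunion]
    calc _ ≤ ∑ i, {w | f i w = 0}.ncard := Set.ncard_iUnion_le_of_fintype _
      _ ≤ ∑ _i : Fin n, n := Finset.sum_le_sum fun i _ => by
          have := hzero i
          rwa [← (hfin i).cast_ncard_eq, Nat.cast_le] at this
      _ = n ^ 2 := by simp [sq]
  have hneg {ε : Fin n → Bool} {i : Fin n} (h : ε i = true) : f i (z ε) < 0 := by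
    have := hz ε i
    rw [if_pos h] at this
    exact sub_neg.2 this
  have hposf {ε : Fin n → Bool} {i : Fin n} (h : ε i = false) : 0 < f i (z ε) := by
    have := hz ε i
    rw [if_neg (by simp [h])] at this
    exact sub_pos.2 this
  have hZne : {w | ∃ i, f i w = 0}.Nonempty := by
    let i : Fin n := ⟨0, by omega⟩
    obtain ⟨t, ht⟩ := mem_range_of_exists_le_of_exists_ge ((hf i).comp Circle.exp.continuous)
      (c := 0) ⟨(z fun _ => true).val.arg, by
        simpa [Circle.exp_arg] using (hneg (ε := fun _ => true) (i := i) rfl).le⟩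
      ⟨(z fun _ => false).val.arg, by
        simpa [Circle.exp_arg] using (hposf (ε := fun _ => false) (i := i) rfl).le⟩
    exact ⟨Circle.exp t, i, ht⟩
  have hcard : 2 ^ n ≤ n ^ 2 := by
    have := card_le_ncard_zeros_of_sign_patterns_ne f hf hZfin hZne z
      (fun ε i => by
        cases h : ε i
        · exact (hposf h).ne'
        · exact (hneg h).ne)
      (fun ε δ hne => by
        obtain ⟨i, hi⟩ := Function.ne_iff.1 hne
        refine ⟨i, ?_⟩
        cases h : ε i <;> cases h' : δ i
        · simp [h, h'] at hi
        · exact mul_neg_of_pos_of_neg (hposf h) (hneg h')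
        · exact mul_neg_of_neg_of_pos (hneg h) (hposf h')
        · simp [h, h'] at hi)
    simpa using this.trans hZcard
  refine ⟨hcard, ?_⟩
  by_contra! hn4
  subst hn
  exact (sq_two_mul_lt_two_pow (by omega)).not_ge hcard
end

section
/- Any 4 pairwise distinct points of the curve Γ_4 = {(cos t, sin t, cos 2t, sin 2t) : t ∈ ℝ} ⊂ ℝ^4 are affinely independent; consequently any 4 pairwise distinct points of Γ_4 are contained in a unique affine hyperplane of ℝ^4. -/
open Real

/-- The closed trigonometric curve
`Γ₄ = {(cos t, sin t, cos 2t, sin 2t) : t ∈ ℝ} ⊂ ℝ^4`. -/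
def Gamma4 : Set (Fin 4 → ℝ) :=
  {p | ∃ t : ℝ, p = ![cos t, sin t, cos (2 * t), sin (2 * t)]}

/-- Over `ℂ`, the points of the curve are `(z, z²)` with `|z| = 1`; multiplying the affine
relations and their conjugates by `conj z ^ 2` turns them into a Vandermonde system. -/
theorem affineIndependent_of_mem_Gamma4
    (p : Fin 4 → (Fin 4 → ℝ)) (hmem : ∀ i, p i ∈ Gamma4)
    (hinj : Function.Injective p) : AffineIndependent ℝ p := by
  choose t ht using hmem
  rw [affineIndependent_iff_of_fintype]
  intro w hw hsum
  rw [Finset.univ.weightedVSub_eq_linear_combination hw] at hsum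
  have hcoord : ∀ k, ∑ i, (w i : ℂ) * (p i k : ℂ) = 0 := by
    intro k
    have := congrFun hsum k
    simp only [Finset.sum_apply, Pi.smul_apply, smul_eq_mul, Pi.zero_apply] at this
    exact_mod_cast this
  have hw' : ∑ i, (w i : ℂ) = 0 := by exact_mod_cast hw
  have p0 : ∀ i, p i 0 = cos (t i) := fun i => by rw [ht]; rfl
  have p1 : ∀ i, p i 1 = sin (t i) := fun i => by rw [ht]; rfl
  have p2 : ∀ i, p i 2 = 2 * p i 0 ^ 2 - 1 := fun i => by
    rw [p0, ← cos_two_mul, ht]; rfl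
  have p3 : ∀ i, p i 3 = 2 * p i 1 * p i 0 := fun i => by
    rw [p0, p1, ← sin_two_mul, ht]; rfl
  have hcirc : ∀ i, (p i 0 : ℂ) ^ 2 + (p i 1 : ℂ) ^ 2 = 1 := fun i => by
    have : p i 0 ^ 2 + p i 1 ^ 2 = 1 := by rw [p0, p1, cos_sq_add_sin_sq]
    exact_mod_cast this
  have hcc : ∀ i, ((p i 0 : ℂ) - p i 1 * Complex.I) * (p i 0 + p i 1 * Complex.I) = 1 :=
    fun i => by linear_combination hcirc i - (p i 1 : ℂ) ^ 2 * Complex.I_sq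
  have hz : Function.Injective fun i => (p i 0 : ℂ) + p i 1 * Complex.I := by
    intro i j hij
    have h0 : p i 0 = p j 0 := by simpa using congrArg Complex.re hij
    have h1 : p i 1 = p j 1 := by simpa using congrArg Complex.im hij
    apply hinj
    ext k
    fin_cases k
    · exact h0
    · exact h1
    · change p i 2 = p j 2
      rw [p2, p2, h0]
    · change p i 3 = p j 3
      rw [p3, p3, h0, h1]
  have hlin : ∀ a b c d e : ℂ, ∑ i, (w i : ℂ) *
      (a + b * p i 0 + c * p i 1 + d * p i 2 + e * p i 3) = 0 := by
    intro a b c d e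
    calc _ = a * ∑ i, (w i : ℂ) + b * ∑ i, (w i : ℂ) * p i 0 + c * ∑ i, (w i : ℂ) * p i 1
          + d * ∑ i, (w i : ℂ) * p i 2 + e * ∑ i, (w i : ℂ) * p i 3 := by
          simp only [Finset.mul_sum, ← Finset.sum_add_distrib]
          exact Finset.sum_congr rfl fun i _ => by ring
      _ = 0 := by simp only [hcoord, hw', mul_zero, add_zero]
  have hu := Matrix.eq_zero_of_forall_pow_sum_mul_pow_eq_zero hz
    (v := fun i => (w i : ℂ) * ((p i 0 : ℂ) - p i 1 * Complex.I) ^ 2) (by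
      have p2c : ∀ i, (p i 2 : ℂ) = 2 * (p i 0 : ℂ) ^ 2 - 1 := fun i => by rw [p2]; push_cast; rfl
      have p3c : ∀ i, (p i 3 : ℂ) = 2 * p i 1 * p i 0 := fun i => by rw [p3]; push_cast; rfl
      intro k
      fin_cases k
      · refine Eq.trans (Finset.sum_congr rfl fun i _ => ?_) (hlin 0 0 0 1 (-Complex.I))
        simp only [p2c, p3c]
        linear_combination (w i : ℂ) * (p i 1 : ℂ) ^ 2 * Complex.I_sq - (w i : ℂ) * hcirc i
      · refine Eq.trans (Finset.sum_congr rfl fun i _ => ?_) (hlin 0 1 (-Complex.I) 0 0)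
        change _ * _ ^ 1 = _
        linear_combination (w i : ℂ) * (p i 0 - p i 1 * Complex.I) * hcc i
      · refine Eq.trans (Finset.sum_congr rfl fun i _ => ?_) (hlin 1 0 0 0 0)
        change _ * _ ^ 2 = _
        linear_combination (w i : ℂ) *
          (((p i 0 : ℂ) - p i 1 * Complex.I) * (p i 0 + p i 1 * Complex.I) + 1) * hcc i
      · refine Eq.trans (Finset.sum_congr rfl fun i _ => ?_) (hlin 0 1 Complex.I 0 0)
        change _ * _ ^ 3 = _
        linear_combination (w i : ℂ) * (p i 0 + p i 1 * Complex.I) *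
          (((p i 0 : ℂ) - p i 1 * Complex.I) * (p i 0 + p i 1 * Complex.I) + 1) * hcc i)
  intro i
  have hne : ((p i 0 : ℂ) - p i 1 * Complex.I) ^ 2 ≠ 0 :=
    pow_ne_zero 2 (left_ne_zero_of_mul_eq_one (hcc i))
  exact_mod_cast (mul_eq_zero.mp (congrFun hu i)).resolve_right hne

/-- Any `4` pairwise distinct points of the curve `Γ₄` are affinely independent, and hence
are contained in a unique affine hyperplane (`3`-dimensional affine subspace) of `ℝ^4`. -/
theorem Gamma4_points_affinely_independent
    (p : Fin 4 → (Fin 4 → ℝ)) (hmem : ∀ i, p i ∈ Gamma4)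
    (hinj : Function.Injective p) :
    AffineIndependent ℝ p ∧
    ∃! H : AffineSubspace ℝ (Fin 4 → ℝ),
      Module.finrank ℝ H.direction = 3 ∧ ∀ i, p i ∈ H := by
  have hp := affineIndependent_of_mem_Gamma4 p hmem hinj
  refine ⟨hp, affineSpan ℝ (Set.range p), ⟨?_, fun i => mem_affineSpan ℝ ⟨i, rfl⟩⟩, ?_⟩
  · rw [direction_affineSpan]
    exact hp.finrank_vectorSpan (by simp)
  · rintro H ⟨hH, hpH⟩
    refine (hp.affineSpan_eq_of_le_of_card_eq_finrank_add_one ?_ (by simp [hH])).symm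
    exact affineSpan_le.mpr (Set.range_subset_iff.mpr hpH)
end

section
/- Let p : ℝ → ℝ be a continuously differentiable function satisfying p(t + π) = −p(t) for all t ∈ ℝ, and suppose 0 is a regular value of p, i.e. p'(t) ≠ 0 whenever p(t) = 0. Then the set of zeros of p in the interval [0, π) is finite and has odd cardinality. -/
open Real

open Filter Topology in
/-- A function that is differentiable with nonvanishing derivative at its zeros has isolated
zeros. -/
theorem eventually_ne_zero_of_regular {p : ℝ → ℝ} (hp : Differentiable ℝ p)
    (hreg : ∀ t : ℝ, p t = 0 → deriv p t ≠ 0) (x : ℝ) : ∀ᶠ y in 𝓝[≠] x, p y ≠ 0 := by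
  by_cases hx : p x = 0
  · exact (hp x).hasDerivAt.eventually_ne (hreg x hx)
  · exact (hp.continuous.continuousAt.eventually_ne hx).filter_mono nhdsWithin_le_nhds

open Filter Topology in
/-- A function with isolated zeros has finitely many zeros in each compact set. -/
theorem IsCompact.finite_zeros {p : ℝ → ℝ} (h : ∀ x, ∀ᶠ y in 𝓝[≠] x, p y ≠ 0)
    {K : Set ℝ} (hK : IsCompact K) : {t ∈ K | p t = 0}.Finite := by
  by_contra hinf
  obtain ⟨x, -, hx⟩ := Set.Infinite.exists_accPt_of_subset_isCompact hinf hK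
    (Set.sep_subset K _)
  obtain ⟨y, ⟨hy, hyK⟩, hne⟩ := ((accPt_iff_frequently.mp hx).and_eventually
    (eventually_nhdsWithin_iff.mp (h x))).exists
  exact hne hy hyK.2

/-- The number of zeros between `a` and `b`, all of them simple, has the parity dictated by the
signs at the endpoints. -/
theorem neg_one_pow_card_zeros_mul_pos {a b : ℝ} (hab : a ≤ b) (S : Finset ℝ) :
    ∀ f : ℝ → ℝ, Continuous f → (∀ x ∈ S, x ∈ Set.Ioo a b) →
      (∀ x ∈ Set.Icc a b, f x = 0 ↔ x ∈ S) →
      (∀ x ∈ S, DifferentiableAt ℝ f x ∧ deriv f x ≠ 0) →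
      0 < (-1) ^ S.card * (f a * f b) := by
  induction S using Finset.induction_on with
  | empty =>
    intro f hf _ hzero _
    simp only [Finset.card_empty, pow_zero, one_mul]
    by_contra! hneg
    have hmem : (0 : ℝ) ∈ Set.uIcc (f a) (f b) := by
      rw [Set.mem_uIcc]
      rcases mul_nonpos_iff.mp hneg with h | h
      · exact Or.inr ⟨h.2, h.1⟩
      · exact Or.inl h
    obtain ⟨x, hx, hfx⟩ := intermediate_value_uIcc hf.continuousOn hmem
    rw [Set.uIcc_of_le hab] at hx
    simpa using (hzero x hx).mp hfx
  | insert z S hz ih =>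
    intro f hf hS hzero hder
    have hzI := hS z (Finset.mem_insert_self z S)
    have hfz : f z = 0 := (hzero z ⟨hzI.1.le, hzI.2.le⟩).mpr (Finset.mem_insert_self z S)
    obtain ⟨hdz, hdz'⟩ := hder z (Finset.mem_insert_self z S)
    have hfactor : ∀ x, f x = (x - z) * dslope f z x := fun x => by
      have := sub_smul_dslope f z x
      rw [hfz, sub_zero, smul_eq_mul] at this
      exact this.symm
    have hcont : Continuous (dslope f z) := by
      rw [← continuousOn_univ, continuousOn_dslope Filter.univ_mem]
      exact ⟨hf.continuousOn, hdz⟩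
    have hzero' : ∀ x ∈ Set.Icc a b, dslope f z x = 0 ↔ x ∈ S := by
      intro x hx
      rcases eq_or_ne x z with rfl | hne
      · simp [dslope_same, hdz', hz]
      · have := hzero x hx
        rw [hfactor x, mul_eq_zero, Finset.mem_insert] at this
        simpa [sub_eq_zero, hne] using this
    have hder' : ∀ x ∈ S, DifferentiableAt ℝ (dslope f z) x ∧ deriv (dslope f z) x ≠ 0 := by
      intro x hx
      have hne : x ≠ z := fun h => hz (h ▸ hx)
      obtain ⟨hd, hd'⟩ := hder x (Finset.mem_insert_of_mem hx)
      have hg : DifferentiableAt ℝ (dslope f z) x := (differentiableAt_dslope_of_ne hne).mpr hd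
      refine ⟨hg, fun h0 => hd' ?_⟩
      have hxI := hS x (Finset.mem_insert_of_mem hx)
      have hgx := (hzero' x ⟨hxI.1.le, hxI.2.le⟩).mpr hx
      have hprod := ((hasDerivAt_id x).sub_const z).mul hg.hasDerivAt
      rw [show f = (fun y => id y - z) * dslope f z from funext hfactor, hprod.deriv]
      simp [h0, hgx]
    have hpos := ih (dslope f z) hcont (fun x hx => hS x (Finset.mem_insert_of_mem hx))
      hzero' hder'
    have hsign : 0 < (z - a) * (b - z) := mul_pos (sub_pos.mpr hzI.1) (sub_pos.mpr hzI.2)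
    rw [Finset.card_insert_of_notMem hz, hfactor a, hfactor b]
    calc 0 < (z - a) * (b - z) * ((-1) ^ S.card * (dslope f z a * dslope f z b)) :=
          mul_pos hsign hpos
      _ = _ := by ring

/-- If `p : ℝ → ℝ` is continuously differentiable, anti-periodic with anti-period `π`
(so that `p` is an odd function on the circle `ℝ/2πℤ`), and `0` is a regular value of
`p`, then `p` has finitely many zeros in `[0, π)` and their number is odd. -/
theorem odd_number_of_zeros
    (p : ℝ → ℝ) (hp : ContDiff ℝ 1 p)
    (hanti : ∀ t : ℝ, p (t + π) = -p t)
    (hreg : ∀ t : ℝ, p t = 0 → deriv p t ≠ 0) :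
    {t ∈ Set.Ico 0 π | p t = 0}.Finite ∧ Odd {t ∈ Set.Ico 0 π | p t = 0}.ncard := by
  have hdiff : Differentiable ℝ p := hp.differentiable one_ne_zero
  have hisol := eventually_ne_zero_of_regular hdiff hreg
  have hfin : {t ∈ Set.Ico 0 π | p t = 0}.Finite :=
    ((isCompact_Icc (a := 0) (b := π)).finite_zeros hisol).subset
      fun t ht => ⟨Set.Ico_subset_Icc_self ht.1, ht.2⟩
  refine ⟨hfin, ?_⟩
  obtain ⟨l, hl, hlne⟩ := mem_nhdsLT_iff_exists_Ioo_subset.mp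
    ((hisol 0).filter_mono (nhdsWithin_mono 0 fun x (hx : x < 0) => hx.ne))
  obtain ⟨c, hlc, hc⟩ := exists_between (Set.mem_Iio.mp hl)
  have hne : ∀ x, c ≤ x → x < 0 → p x ≠ 0 := fun x h1 h2 => hlne ⟨hlc.trans_le h1, h2⟩
  have hne' : ∀ x, c + π ≤ x → x < π → p x ≠ 0 := fun x h1 h2 h0 => by
    refine hne (x - π) (by linarith) (by linarith) ?_
    have := hanti (x - π)
    rw [sub_add_cancel, h0] at this
    linarith
  have hpos := neg_one_pow_card_zeros_mul_pos (a := c) (b := c + π) (by linarith [pi_pos])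
    hfin.toFinset p hp.continuous
    (fun x hx => by
      obtain ⟨⟨h0, hπ⟩, hx0⟩ := hfin.mem_toFinset.mp hx
      exact ⟨hc.trans_le h0, not_le.mp fun h => hne' x h hπ hx0⟩)
    (fun x hx => by
      rw [hfin.mem_toFinset]
      exact ⟨fun h => ⟨⟨not_lt.mp fun h0 => hne x hx.1 h0 h, by linarith [hx.2]⟩, h⟩,
        fun h => h.2⟩)
    (fun x hx => ⟨hdiff x, hreg x (hfin.mem_toFinset.mp hx).2⟩)
  rw [hanti, ← Set.ncard_eq_toFinset_card _ hfin] at hpos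
  by_contra hodd
  rw [(Nat.not_odd_iff_even.mp hodd).neg_one_pow] at hpos
  linarith [mul_self_nonneg (p c)]
end

section
/- Identify ℝ^4 with the affine hyperplane {x ∈ ℝ^5 : x_5 = 1} via e(x) = (x,1), and let θ be the pushforward to ℝ^4 of Lebesgue measure on [0, 2π) under the map t ↦ (cos t, sin t, cos 2t, sin 2t); θ is a finite measure of total mass 2π concentrated on the curve Γ_4. For u ∈ S^4 ⊂ ℝ^5 let H_u^0 = {x ∈ ℝ^4 : ⟨e(x), u⟩ ≥ 0} and H_u^1 = {x ∈ ℝ^4 : ⟨e(x), u⟩ ≤ 0}. Define the solution set Σ_θ := {(u_1, u_2, u_3, u_4) ∈ (S^4)^4_δ : θ(H_{u_1}^{β_1} ∩ H_{u_2}^{β_2} ∩ H_{u_3}^{β_3} ∩ H_{u_4}^{β_4}) = 2π/16 for every β ∈ {0,1}^4}. Then Σ_θ has exactly |W_4| = 2^4·4! = 384 connected components, each component is homeomorphic to the circle S^1, and the W_4-action on (S^4)^4_δ permutes these components transitively. -/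
open MeasureTheory

/-- The closed trigonometric (convex) curve `Γ₄`, parametrized by
`t ↦ (cos t, sin t, cos 2t, sin 2t) ∈ ℝ^4`. -/
noncomputable def curve4 (t : ℝ) : EuclideanSpace ℝ (Fin 4) :=
  (WithLp.equiv 2 (Fin 4 → ℝ)).symm
    ![Real.cos t, Real.sin t, Real.cos (2 * t), Real.sin (2 * t)]

/-- The "arc length" measure `θ` on `Γ₄`: the pushforward to `ℝ^4` of Lebesgue measure on
`[0, 2π)` under `curve4`; a finite measure of total mass `2π` concentrated on `Γ₄`. -/
noncomputable def thetaMeasure : Measure (EuclideanSpace ℝ (Fin 4)) :=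
  Measure.map curve4 (volume.restrict (Set.Ico 0 (2 * Real.pi)))

/-- `⟨e(x), u⟩` where `e : ℝ^4 → ℝ^5`, `e(x) = (x, 1)`, and `u ∈ ℝ^5`. -/
def epair (u : EuclideanSpace ℝ (Fin 5)) (x : EuclideanSpace ℝ (Fin 4)) : ℝ :=
  (∑ i : Fin 4, u (Fin.castSucc i) * x i) + u (Fin.last 4)

/-- The closed half-space `H_u^β` of `ℝ^4` determined by a unit vector `u ∈ S^4 ⊂ ℝ^5`:
`H_u^0 = {x | ⟨e(x), u⟩ ≥ 0}` (`β = false`) and `H_u^1 = {x | ⟨e(x), u⟩ ≤ 0}`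
(`β = true`). -/
def sphereHalfspace (u : EuclideanSpace ℝ (Fin 5)) (β : Bool) :
    Set (EuclideanSpace ℝ (Fin 4)) :=
  if β then {x | epair u x ≤ 0} else {x | 0 ≤ epair u x}

/-- The solution set `Σ_θ ⊂ (S^4)^4_δ` of all `4`-tuples of pairwise non-equal,
non-antipodal unit vectors of `ℝ^5` whose associated `16` closed orthants all have
`θ`-measure `2π/16`. -/
noncomputable def SolutionSet : Set (Fin 4 → EuclideanSpace ℝ (Fin 5)) :=
  {u | (∀ i, ‖u i‖ = 1) ∧ (∀ i j, i ≠ j → u i ≠ u j ∧ u i ≠ -u j) ∧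
    ∀ β : Fin 4 → Bool,
      thetaMeasure (⋂ i, sphereHalfspace (u i) (β i)) =
        ENNReal.ofReal (2 * Real.pi / 16)}

/-- The action of the element `(ε, σ)` of `W₄ = (ℤ/2)⁴ ⋊ S₄` on a `4`-tuple of vectors. -/
noncomputable def actW (ε : Fin 4 → Bool) (σ : Equiv.Perm (Fin 4))
    (v : Fin 4 → EuclideanSpace ℝ (Fin 5)) : Fin 4 → EuclideanSpace ℝ (Fin 5) :=
  fun i => (if ε i then (-1 : ℝ) else 1) • v (σ⁻¹ i)

open Real Finset

/-- The trigonometric polynomial of degree at most two with coefficient vector `u`. -/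
noncomputable def trig (u : EuclideanSpace ℝ (Fin 5)) (t : ℝ) : ℝ := epair u (curve4 t)

lemma trig_apply (u : EuclideanSpace ℝ (Fin 5)) (t : ℝ) :
    trig u t = u 0 * cos t + u 1 * sin t + u 2 * cos (2 * t) + u 3 * sin (2 * t) + u 4 := by
  simp [trig, epair, curve4, Fin.sum_univ_four]

lemma trig_smul (c : ℝ) (u : EuclideanSpace ℝ (Fin 5)) (t : ℝ) :
    trig (c • u) t = c * trig u t := by
  simp [trig_apply]; ring

lemma trig_sub (u v : EuclideanSpace ℝ (Fin 5)) (t : ℝ) :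
    trig (u - v) t = trig u t - trig v t := by
  simp [trig_apply]; ring

lemma trig_periodic (u : EuclideanSpace ℝ (Fin 5)) : Function.Periodic (trig u) (2 * π) := by
  intro t
  have h : 2 * (t + 2 * π) = 2 * t + 2 * π + 2 * π := by ring
  simp only [trig_apply, h, cos_add_two_pi, sin_add_two_pi]

@[fun_prop]
lemma continuous_trig (u : EuclideanSpace ℝ (Fin 5)) : Continuous (trig u) := by
  have h : trig u = fun t => u 0 * cos t + u 1 * sin t + u 2 * cos (2 * t) +
      u 3 * sin (2 * t) + u 4 := funext (trig_apply u)
  rw [h]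
  fun_prop

open Polynomial in
/-- The polynomial whose values on the unit circle are `z² · trig u`. -/
noncomputable def trigPoly (u : EuclideanSpace ℝ (Fin 5)) : ℂ[X] :=
  C ((u 2 - u 3 * Complex.I) / 2) * X ^ 4 + C ((u 0 - u 1 * Complex.I) / 2) * X ^ 3 +
    C (u 4 : ℂ) * X ^ 2 + C ((u 0 + u 1 * Complex.I) / 2) * X +
    C ((u 2 + u 3 * Complex.I) / 2)

lemma trigPoly_eval (u : EuclideanSpace ℝ (Fin 5)) (t : ℝ) :
    (trigPoly u).eval (Complex.exp (t * Complex.I)) =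
      Complex.exp (t * Complex.I) ^ 2 * (trig u t : ℂ) := by
  have h1 : Complex.exp (t * Complex.I) = Complex.cos t + Complex.sin t * Complex.I :=
    Complex.exp_mul_I _
  have h2 := Complex.cos_sq_add_sin_sq t
  have h3 : Complex.sin t ^ 2 = 1 - Complex.cos t ^ 2 := by linear_combination h2
  have hI : Complex.I ^ 2 = -1 := Complex.I_sq
  rw [trig_apply]
  push_cast
  rw [Complex.cos_two_mul, Complex.sin_two_mul, h1]
  simp only [trigPoly, Polynomial.eval_add, Polynomial.eval_mul, Polynomial.eval_C,
    Polynomial.eval_pow, Polynomial.eval_X]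
  generalize Complex.cos t = c at *
  generalize Complex.sin t = s at *
  generalize Complex.I = j at *
  have h4 : (c + s * j) * (c - s * j) = 1 := by linear_combination h2 - s ^ 2 * hI
  set z := c + s * j with hz
  set w := c - s * j with hw
  have hc : c = (z + w) / 2 := by rw [hz, hw]; ring
  have hs : s * j = (z - w) / 2 := by rw [hz, hw]; ring
  have hs' : s = - j * (z - w) / 2 := by linear_combination (-j) * hs + (s) * hI
  rw [hs', hc]
  generalize (u 0 : ℂ) = u0
  generalize (u 1 : ℂ) = u1
  generalize (u 2 : ℂ) = u2
  generalize (u 3 : ℂ) = u3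
  have h5 : z * w = 1 := h4
  clear_value z w
  linear_combination (-u2 * z * w / 2 - u2 / 2 - u0 * z / 2 - u3 * j / 2 * (z * w + 1) -
     u1 * j * z / 2 - u2 * z ^ 2) * h5

lemma trigPoly_ne_zero {u : EuclideanSpace ℝ (Fin 5)} (hu : u ≠ 0) : trigPoly u ≠ 0 := by
  intro h
  apply hu
  have h4 := congrArg (fun p => p.coeff 4) h
  have h3 := congrArg (fun p => p.coeff 3) h
  have h2 := congrArg (fun p => p.coeff 2) h
  simp [trigPoly, Complex.ext_iff] at h4 h3 h2
  ext i
  fin_cases i <;> simp_all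

lemma exp_mul_I_injOn {S : Finset ℝ} (hS : ∀ x ∈ S, ∀ y ∈ S, x - y < 2 * π) :
    Set.InjOn (fun t : ℝ => Complex.exp (t * Complex.I)) S := by
  intro x hx y hy hxy
  obtain ⟨n, hn⟩ := Complex.exp_eq_exp_iff_exists_int.1 hxy
  have h : x = y + n * (2 * π) := by
    have := congrArg Complex.im hn
    simpa using this
  have h1 := hS x hx y hy
  have h2 := hS y hy x hx
  have hpi := Real.pi_pos
  have h3 : (n : ℝ) < 1 := by nlinarith
  have h4 : (-1 : ℝ) < n := by nlinarith
  have h5 : n = 0 := by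
    have : n < 1 := by exact_mod_cast h3
    have : -1 < n := by exact_mod_cast h4
    omega
  simpa [h5] using h

/-- A nonzero trigonometric polynomial of degree at most two has at most four zeros in a
period. -/
lemma card_le_four_of_trig_eq_zero {u : EuclideanSpace ℝ (Fin 5)} (hu : u ≠ 0) {S : Finset ℝ}
    (hS : ∀ x ∈ S, ∀ y ∈ S, x - y < 2 * π) (h0 : ∀ t ∈ S, trig u t = 0) : #S ≤ 4 := by
  classical
  rw [← Finset.card_image_of_injOn (exp_mul_I_injOn hS)]
  have hdeg : (trigPoly u).natDegree ≤ 4 := by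
    unfold trigPoly
    compute_degree
  refine le_trans ?_ hdeg
  refine Polynomial.card_le_degree_of_subset_roots fun z hz => ?_
  simp only [Finset.image_val, Multiset.mem_dedup, Multiset.mem_map] at hz
  obtain ⟨t, ht, rfl⟩ := hz
  rw [Polynomial.mem_roots (trigPoly_ne_zero hu), Polynomial.IsRoot.def, trigPoly_eval,
    h0 t (by simpa using ht)]
  simp

/-- Unit vectors whose trigonometric polynomials share four zeros, and are positive at a common
point, agree. -/
lemma eq_of_trig_eq_zero {u v : EuclideanSpace ℝ (Fin 5)} (hu : ‖u‖ = 1) (hv : ‖v‖ = 1)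
    {S : Finset ℝ} (hcard : #S = 4) {a t : ℝ} (hS : ∀ x ∈ S, x ∈ Set.Ioc a (a + 2 * π))
    (ht : t ∈ Set.Ioc a (a + 2 * π)) (hu0 : ∀ x ∈ S, trig u x = 0)
    (hv0 : ∀ x ∈ S, trig v x = 0) (hut : 0 < trig u t) (hvt : 0 < trig v t) : u = v := by
  classical
  have htS : t ∉ S := fun h => hut.ne' (hu0 t h)
  have hw : trig v t • u - trig u t • v = 0 := by
    by_contra hne
    have := card_le_four_of_trig_eq_zero hne (S := insert t S) ?_ ?_
    · rw [Finset.card_insert_of_notMem htS] at this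
      omega
    · have key : ∀ x ∈ insert t S, x ∈ Set.Ioc a (a + 2 * π) := by
        intro x hx
        rcases Finset.mem_insert.1 hx with rfl | hx
        exacts [ht, hS x hx]
      intro x hx y hy
      have h1 := key x hx
      have h2 := key y hy
      linarith [h1.2, h2.1]
    · intro x hx
      rw [trig_sub, trig_smul, trig_smul]
      rcases Finset.mem_insert.1 hx with rfl | hx
      · ring
      · rw [hu0 x hx, hv0 x hx]; ring
  have h1 : trig v t • u = trig u t • v := sub_eq_zero.1 hw
  have h2 := congrArg norm h1
  rw [norm_smul, norm_smul, hu, hv, mul_one, mul_one, Real.norm_of_nonneg hut.le,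
    Real.norm_of_nonneg hvt.le] at h2
  rw [h2] at h1
  exact smul_right_injective _ hut.ne' h1

/-- The coefficient vector of `t ↦ ∏ j, sin ((t - a j) / 2)`. -/
noncomputable def rootVec (a : Fin 4 → ℝ) : EuclideanSpace ℝ (Fin 5) :=
  !₂[-(cos ((a 0 - a 1) / 2) * cos ((a 2 + a 3) / 2) +
        cos ((a 2 - a 3) / 2) * cos ((a 0 + a 1) / 2)) / 4,
    -(cos ((a 0 - a 1) / 2) * sin ((a 2 + a 3) / 2) +
        cos ((a 2 - a 3) / 2) * sin ((a 0 + a 1) / 2)) / 4,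
    cos ((a 0 + a 1) / 2 + (a 2 + a 3) / 2) / 8,
    sin ((a 0 + a 1) / 2 + (a 2 + a 3) / 2) / 8,
    (cos ((a 0 - a 1) / 2) * cos ((a 2 - a 3) / 2) +
        cos ((a 0 + a 1) / 2 - (a 2 + a 3) / 2) / 2) / 4]

lemma sin_half_sub_mul_sin_half_sub (t a b : ℝ) :
    sin ((t - a) / 2) * sin ((t - b) / 2) = (cos ((a - b) / 2) - cos (t - (a + b) / 2)) / 2 := by
  have h1 : (a - b) / 2 = (t - b) / 2 - (t - a) / 2 := by ring
  have h2 : t - (a + b) / 2 = (t - b) / 2 + (t - a) / 2 := by ring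
  rw [h1, h2, cos_sub, cos_add]
  ring

lemma trig_rootVec (a : Fin 4 → ℝ) (t : ℝ) :
    trig (rootVec a) t = ∏ j, sin ((t - a j) / 2) := by
  rw [Fin.prod_univ_four, mul_assoc, sin_half_sub_mul_sin_half_sub,
    sin_half_sub_mul_sin_half_sub, trig_apply]
  simp only [rootVec, PiLp.toLp_apply, Matrix.cons_val]
  generalize (a 0 + a 1) / 2 = p
  generalize (a 2 + a 3) / 2 = q
  generalize cos ((a 0 - a 1) / 2) = A
  generalize cos ((a 2 - a 3) / 2) = B
  simp only [cos_two_mul, sin_two_mul, cos_sub, cos_add, sin_add]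
  have h := sin_sq_add_cos_sq t
  linear_combination (- sin p * sin q / 4 ) * h

lemma rootVec_ne_zero (a : Fin 4 → ℝ) : rootVec a ≠ 0 := by
  intro h
  have h2 : rootVec a 2 = 0 := by rw [h]; rfl
  have h3 : rootVec a 3 = 0 := by rw [h]; rfl
  simp only [rootVec, PiLp.toLp_apply, Matrix.cons_val] at h2 h3
  have := sin_sq_add_cos_sq ((a 0 + a 1) / 2 + (a 2 + a 3) / 2)
  nlinarith

lemma continuous_rootVec : Continuous rootVec := by
  refine (PiLp.continuous_toLp 2 _).comp (continuous_pi fun i => ?_)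
  fin_cases i <;> simp <;> fun_prop

/-- The vertices of the `4`-cube visited by the walk starting at `0` that flips the coordinate
`l k` in its `k`-th step. -/
def vertex (l : Fin 16 → Fin 4) (m : Fin 16) (i : Fin 4) : Bool :=
  decide (Odd #{k | l k = i ∧ k < m})

/-- Transition sequences of the balanced cyclic Gray codes on four bits, based at `0`. -/
structure IsBalancedGray (l : Fin 16 → Fin 4) : Prop where
  card_fiber : ∀ i, #{k | l k = i} = 4
  injective : Function.Injective (vertex l)

/-- The vertex reached after `n` steps of the walk `f`, encoded in binary. -/
def walk (f : ℕ → Fin 4) : ℕ → ℕ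
  | 0 => 0
  | n + 1 => walk f n ^^^ 2 ^ (f n : ℕ)

/-- The list of the first `n` values of `f`, latest first. -/
def initialValues (f : ℕ → Fin 4) (n : ℕ) : List (Fin 4) := ((List.range n).map f).reverse

/-- Whether no vertex reached by successively flipping `w` along `l` is `0`. -/
def avoidsZero (w : ℕ) : List (Fin 4) → Bool
  | [] => w != 0
  | x :: l => w != 0 && avoidsZero (w ^^^ 2 ^ (x : ℕ)) l

/-- Whether the (reversed) beginning `l` of a balanced Gray code whose labels appear in increasing
order can be continued with the label `b`. -/
def canExtend (l : List (Fin 4)) (b : Fin 4) : Bool :=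
  Nat.ble (l.count b) 3 && (b == 0 || l.contains (b - 1)) &&
    (Nat.ble 15 l.length || avoidsZero (2 ^ (b : ℕ)) l)

/-- All reversed continuations of `l` by `n` labels. -/
def extensions : ℕ → List (Fin 4) → List (List (Fin 4))
  | 0, l => [l]
  | n + 1, l => [0, 1, 2, 3].flatMap fun b =>
      if canExtend l b then extensions n (b :: l) else []

/-- A balanced Gray code. -/
def grayLabels : Fin 16 → Fin 4 := ![0, 1, 0, 2, 0, 3, 2, 1, 2, 3, 0, 3, 1, 2, 1, 3]

/-- Whether the list factors through the labels `g` as a function of the index. -/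
def factorsThrough (g : Fin 16 → Fin 4) (l : List (Fin 4)) : Bool :=
  (List.finRange 16).all fun j => (List.finRange 16).all fun j' =>
    g j != g j' || l.getD j 0 == l.getD j' 0

set_option maxRecDepth 100000 in
lemma extensions_factorsThrough :
    ((extensions 16 []).all fun l => (List.finRange 16).any fun k =>
      factorsThrough (fun j => grayLabels (j + k)) l.reverse) = true := by
  decide +kernel

set_option maxRecDepth 100000 in
lemma card_fiber_grayLabels_add (k : Fin 16) (c : Fin 4) :
    #{j | grayLabels (j + k) = c} = 4 := by
  revert k c; decide +kernel

set_option maxRecDepth 100000 in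
lemma vertex_grayLabels_add_injective (k : Fin 16) : ∀ m m',
    (∀ i, vertex (fun j => grayLabels (j + k)) m i = vertex (fun j => grayLabels (j + k)) m' i) →
      m = m' := by
  revert k; decide +kernel

lemma initialValues_succ (f : ℕ → Fin 4) (n : ℕ) :
    initialValues f (n + 1) = f n :: initialValues f n := by
  simp [initialValues, List.range_succ]

lemma mem_initialValues {f : ℕ → Fin 4} {n : ℕ} {b : Fin 4} :
    b ∈ initialValues f n ↔ ∃ k < n, f k = b := by
  simp [initialValues]

lemma length_initialValues (f : ℕ → Fin 4) (n : ℕ) : (initialValues f n).length = n := by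
  simp [initialValues]

lemma count_initialValues (f : ℕ → Fin 4) (n : ℕ) (b : Fin 4) :
    (initialValues f n).count b = #{k ∈ range n | f k = b} := by
  induction n with
  | zero => simp [initialValues]
  | succ n ih =>
    rw [initialValues_succ, List.count_cons, ih, Finset.range_add_one, Finset.filter_insert]
    split_ifs with h1 h2 h2 <;> simp_all

lemma testBit_walk (f : ℕ → Fin 4) (n : ℕ) (i : Fin 4) :
    (walk f n).testBit i = decide (Odd #{k ∈ range n | f k = i}) := by
  induction n with
  | zero => simp [walk]
  | succ n ih =>
    rw [walk, Nat.testBit_xor, ih, Finset.range_add_one, Finset.filter_insert,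
      Nat.testBit_two_pow]
    split_ifs with h
    · rw [Finset.card_insert_of_notMem (by simp)]
      simp [h, Nat.odd_add_one, -Nat.not_odd_iff_even]
    · simp [Fin.val_inj, h]

lemma avoidsZero_initialValues {f : ℕ → Fin 4} {n y : ℕ} (h : ∀ m ≤ n, y ≠ walk f m) :
    avoidsZero (y ^^^ walk f n) (initialValues f n) = true := by
  induction n with
  | zero => simpa [avoidsZero, initialValues, walk] using h 0 le_rfl
  | succ n ih =>
    rw [initialValues_succ, avoidsZero, walk, ← Nat.xor_assoc, Nat.xor_assoc _ (2 ^ (f n : ℕ)),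
      Nat.xor_self, Nat.xor_zero, ih fun m hm => h m (by omega), Bool.and_true, Nat.xor_assoc]
    have := h (n + 1) le_rfl
    simpa [Nat.xor_eq_zero_iff, walk] using this

lemma initialValues_mem_extensions {f : ℕ → Fin 4} {k n : ℕ}
    (h : ∀ j, n ≤ j → j < n + k → canExtend (initialValues f j) (f j) = true) :
    initialValues f (n + k) ∈ extensions k (initialValues f n) := by
  induction k generalizing n with
  | zero => simp [extensions]
  | succ k ih =>
    rw [extensions, List.mem_flatMap]
    refine ⟨f n, ?_, ?_⟩
    · generalize f n = b
      fin_cases b <;> simp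
    · rw [if_pos (h n le_rfl (by omega)), ← initialValues_succ, show n + (k + 1) = n + 1 + k by ring]
      exact ih fun j hj hj' => h j (by omega) (by omega)

/-- The periodic extension of a sequence of labels. -/
def periodicExt (l : Fin 16 → Fin 4) (n : ℕ) : Fin 4 := l (Fin.ofNat 16 n)

lemma periodicExt_val (l : Fin 16 → Fin 4) (k : Fin 16) : periodicExt l k = l k := by
  simp [periodicExt]

lemma card_filter_periodicExt (l : Fin 16 → Fin 4) {n : ℕ} (hn : n ≤ 16) (i : Fin 4) :
    #{k ∈ range n | periodicExt l k = i} = #{k : Fin 16 | l k = i ∧ (k : ℕ) < n} := by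
  symm
  refine Finset.card_bij (fun k _ => (k : ℕ)) ?_ ?_ ?_
  · intro k hk
    simp only [mem_filter, mem_univ, true_and] at hk
    simp [periodicExt_val, hk]
  · intro a _ b _ h
    exact Fin.ext h
  · intro k hk
    simp only [mem_filter, mem_range] at hk
    refine ⟨⟨k, by omega⟩, ?_, rfl⟩
    have := periodicExt_val l ⟨k, by omega⟩
    simp only at this
    simp [← this, hk]

lemma testBit_walk_periodicExt (l : Fin 16 → Fin 4) (m : Fin 16) (i : Fin 4) :
    (walk (periodicExt l) m).testBit i = vertex l m i := by
  rw [testBit_walk, card_filter_periodicExt l m.is_lt.le]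
  rfl

lemma canExtend_periodicExt {l : Fin 16 → Fin 4} (hl : IsBalancedGray l)
    (hc : ∀ j, l j = 0 ∨ ∃ j' < j, l j' = l j - 1) (j : Fin 16) :
    canExtend (initialValues (periodicExt l) j) (periodicExt l j) = true := by
  simp only [canExtend, Bool.and_eq_true, Bool.or_eq_true, Nat.ble_eq, beq_iff_eq,
    List.contains_iff_mem, mem_initialValues, length_initialValues, count_initialValues,
    periodicExt_val]
  refine ⟨⟨?_, ?_⟩, ?_⟩
  · rw [card_filter_periodicExt l j.is_lt.le]
    have h : ({k : Fin 16 | l k = l j ∧ (k : ℕ) < j} : Finset (Fin 16)) ⊂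
        ({k : Fin 16 | l k = l j} : Finset (Fin 16)) := by
      refine ⟨fun k hk => ?_, fun h => ?_⟩
      · simp_all
      · have := @h j (by simp)
        simp at this
    have := Finset.card_lt_card h
    rw [hl.card_fiber] at this
    omega
  · refine (hc j).imp id ?_
    rintro ⟨j', hj', h⟩
    exact ⟨j', hj', by rw [periodicExt_val, h]⟩
  · rw [or_iff_not_imp_left]
    intro hj
    have h2 : walk (periodicExt l) (j + 1) ^^^ walk (periodicExt l) j = 2 ^ (l j : ℕ) := by
      rw [walk, periodicExt_val, Nat.xor_comm, ← Nat.xor_assoc, Nat.xor_self, Nat.zero_xor]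
    rw [← h2]
    refine avoidsZero_initialValues fun m hm h => ?_
    have : (⟨j + 1, by omega⟩ : Fin 16) = ⟨m, by omega⟩ := by
      apply hl.injective
      funext i
      rw [← testBit_walk_periodicExt, ← testBit_walk_periodicExt]
      simp only [h]
    have := congrArg Fin.val this
    simp only at this
    omega

/-- The labels can be permuted so that they appear in increasing order. -/
lemma exists_perm_increasing (l : Fin 16 → Fin 4) :
    ∃ σ : Equiv.Perm (Fin 4), ∀ j, σ (l j) = 0 ∨ ∃ j' < j, σ (l j') = σ (l j) - 1 := by
  obtain ⟨σ, hσ⟩ := Finite.exists_min fun σ : Equiv.Perm (Fin 4) => toLex (fun j => σ (l j))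
  refine ⟨σ, fun j => ?_⟩
  induction j using WellFoundedLT.induction with
  | ind j ih =>
    by_contra! h
    obtain ⟨h0, h1⟩ := h
    set a := σ (l j) - 1 with ha
    have hab : a < σ (l j) := by
      rw [ha]
      revert h0
      generalize σ (l j) = b
      revert b
      decide
    have hb : ∀ j' < j, σ (l j') ≠ σ (l j) := by
      intro j' hj' he
      rcases ih j' hj' with h | ⟨j'', hj'', h⟩
      · exact h0 (he ▸ h)
      · exact h1 j'' (hj''.trans hj') (by rw [h, he])
    refine (hσ (σ.trans (Equiv.swap a (σ (l j))))).not_gt ?_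
    refine ⟨j, fun j' hj' => ?_, ?_⟩
    · exact Equiv.swap_apply_of_ne_of_ne (h1 j' hj') (hb j' hj')
    · simpa using hab

lemma IsBalancedGray.comp_perm {l : Fin 16 → Fin 4} (hl : IsBalancedGray l)
    (σ : Equiv.Perm (Fin 4)) : IsBalancedGray fun j => σ (l j) := by
  have h : ∀ k i, σ (l k) = i ↔ l k = σ.symm i := fun k i => (σ.eq_symm_apply).symm
  refine ⟨fun i => ?_, fun m m' hm => hl.injective ?_⟩
  · simp_rw [h]
    exact hl.card_fiber _
  · funext i
    have := congrFun hm (σ i)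
    simpa [vertex] using this

lemma surjective_of_card_fiber {l : Fin 16 → Fin 4} (hl : ∀ i, #{k | l k = i} = 4) :
    Function.Surjective l := by
  intro i
  have h : 0 < #{k | l k = i} := by rw [hl]; norm_num
  obtain ⟨k, hk⟩ := Finset.card_pos.1 h
  exact ⟨k, by simpa using hk⟩

/-- Up to relabelling and rotation there is only one balanced Gray code on four bits. -/
lemma isBalancedGray_iff {l : Fin 16 → Fin 4} : IsBalancedGray l ↔
    ∃ (σ : Equiv.Perm (Fin 4)) (k : Fin 16), l = fun j => σ (grayLabels (j + k)) := by
  constructor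
  · intro hl
    obtain ⟨τ, hτ⟩ := exists_perm_increasing l
    have hg := hl.comp_perm τ
    set g : Fin 16 → Fin 4 := fun j => τ (l j) with hgdef
    have hmem : initialValues (periodicExt g) (0 + 16) ∈
        extensions 16 (initialValues (periodicExt g) 0) :=
      initialValues_mem_extensions fun j _ hj =>
        canExtend_periodicExt hg hτ ⟨j, by omega⟩
    have hall := List.all_eq_true.1 extensions_factorsThrough _ hmem
    obtain ⟨k, -, hk⟩ := List.any_eq_true.1 hall
    have hget : ∀ j : Fin 16, (initialValues (periodicExt g) 16).reverse.getD j 0 = g j := by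
      intro j
      simp [initialValues, List.getD_eq_getElem?_getD, periodicExt_val]
    have hfac : ∀ j j', grayLabels (j + k) = grayLabels (j' + k) → g j = g j' := by
      intro j j' h
      simp only [factorsThrough, List.all_eq_true, zero_add, hget] at hk
      simpa [h] using hk j (List.mem_finRange j) j' (List.mem_finRange j')
    have hsur : ∀ c, ∃ j, grayLabels j = c := by decide
    choose r hr using hsur
    have hρ : ∀ j, g (r (grayLabels (j + k)) - k) = g j := by
      intro j
      apply hfac
      rw [sub_add_cancel, hr]
    have hsurj : Function.Surjective fun c => g (r c - k) := by
      intro i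
      obtain ⟨j, rfl⟩ := surjective_of_card_fiber hg.card_fiber i
      exact ⟨_, hρ j⟩
    refine ⟨(Equiv.ofBijective _ hsurj.bijective_of_finite).trans τ.symm, k, ?_⟩
    funext j
    simpa [hgdef] using (hρ j).symm
  · rintro ⟨σ, k, rfl⟩
    have : IsBalancedGray fun j => grayLabels (j + k) :=
      ⟨card_fiber_grayLabels_add k, fun m m' h =>
        vertex_grayLabels_add_injective k m m' fun i => congrFun h i⟩
    exact this.comp_perm σ

lemma eq_zero_of_grayLabels_add : ∀ d : Fin 16,
    (∀ j j', grayLabels j = grayLabels j' → grayLabels (j + d) = grayLabels (j' + d)) →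
      d = 0 := by
  decide +kernel

lemma card_isBalancedGray : Nat.card {l : Fin 16 → Fin 4 // IsBalancedGray l} = 384 := by
  let F : Equiv.Perm (Fin 4) × Fin 16 → {l : Fin 16 → Fin 4 // IsBalancedGray l} :=
    fun p => ⟨fun j => p.1 (grayLabels (j + p.2)), isBalancedGray_iff.2 ⟨p.1, p.2, rfl⟩⟩
  have hF : Function.Bijective F := by
    constructor
    · rintro ⟨σ, k⟩ ⟨σ', k'⟩ h
      have h' : ∀ j, σ (grayLabels (j + k)) = σ' (grayLabels (j + k')) :=
        fun j => congrFun (congrArg Subtype.val h) j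
      have hk : k' - k = 0 := by
        refine eq_zero_of_grayLabels_add _ fun j j' hj => σ'.injective ?_
        have h1 := h' (j - k)
        have h2 := h' (j' - k)
        rw [sub_add_cancel] at h1 h2
        rw [show j + (k' - k) = j - k + k' by abel, show j' + (k' - k) = j' - k + k' by abel,
          ← h1, ← h2, hj]
      obtain rfl : k' = k := sub_eq_zero.1 hk
      have hsur : ∀ c, ∃ j, grayLabels j = c := by decide
      refine Prod.ext (Equiv.ext fun c => ?_) rfl
      obtain ⟨j, rfl⟩ := hsur c
      simpa using h' (j - k')
    · rintro ⟨l, hl⟩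
      obtain ⟨σ, k, rfl⟩ := isBalancedGray_iff.1 hl
      exact ⟨(σ, k), rfl⟩
  rw [← Nat.card_eq_of_bijective F hF, Nat.card_prod, Nat.card_eq_fintype_card,
    Fintype.card_perm, Nat.card_eq_fintype_card, Fintype.card_fin, Fintype.card_fin]
  rfl

/-- Any two balanced Gray codes agree up to relabelling and rotation. -/
lemma IsBalancedGray.exists_eq {l l' : Fin 16 → Fin 4} (hl : IsBalancedGray l)
    (hl' : IsBalancedGray l') :
    ∃ (σ : Equiv.Perm (Fin 4)) (k : Fin 16), l' = fun j => σ (l (j + k)) := by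
  obtain ⟨σ, k, rfl⟩ := isBalancedGray_iff.1 hl
  obtain ⟨σ', k', rfl⟩ := isBalancedGray_iff.1 hl'
  refine ⟨σ.symm.trans σ', k' - k, ?_⟩
  funext j
  simp [add_assoc]

/-- The points cutting the circle into sixteen equal arcs, the first of them starting at `s`. -/
noncomputable def cutPoint (s : ℝ) (k : ℕ) : ℝ := s + k * (π / 8)

lemma cutPoint_succ (s : ℝ) (k : ℕ) : cutPoint s (k + 1) = cutPoint s k + π / 8 := by
  simp only [cutPoint]; push_cast; ring

lemma cutPoint_strictMono (s : ℝ) : StrictMono (cutPoint s) :=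
  strictMono_nat_of_lt_succ fun k => by rw [cutPoint_succ]; linarith [pi_pos]

lemma cutPoint_zero (s : ℝ) : cutPoint s 0 = s := by simp [cutPoint]

lemma cutPoint_sixteen (s : ℝ) : cutPoint s 16 = s + 2 * π := by
  simp only [cutPoint]; push_cast; ring

lemma cutPoint_succ_mem_Ioc (s : ℝ) (k : Fin 16) :
    cutPoint s (k + 1) ∈ Set.Ioc s (s + 2 * π) := by
  have h1 := cutPoint_strictMono s (Nat.succ_pos k)
  have h2 := (cutPoint_strictMono s).monotone (show (k : ℕ) + 1 ≤ 16 by omega)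
  rw [cutPoint_zero] at h1
  rw [cutPoint_sixteen] at h2
  exact ⟨h1, h2⟩

/-- The sign attached to a half-space label. -/
def boolSign (b : Bool) : ℝ := if b then -1 else 1

lemma boolSign_decide_odd (n : ℕ) : boolSign (decide (Odd n)) = (-1) ^ n := by
  by_cases h : Odd n
  · simp [boolSign, h, h.neg_one_pow]
  · simp [boolSign, (Nat.not_odd_iff_even.1 h).neg_one_pow, h]

lemma abs_boolSign (b : Bool) : |boolSign b| = 1 := by
  cases b <;> simp [boolSign]

/-- The label sequences in which all four labels occur equally often. -/
abbrev BalancedSeq := {l : Fin 16 → Fin 4 // ∀ i, #{k | l k = i} = 4}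

/-- The zeros of the `i`-th trigonometric polynomial of the partition with label sequence `g`
starting at `s`. -/
noncomputable def zeroPoint (g : BalancedSeq) (i : Fin 4) (s : ℝ) (j : Fin 4) : ℝ :=
  cutPoint s ((Finset.orderEmbOfFin _ (g.2 i) j : Fin 16) + 1)

/-- The unit vectors of the hyperplanes cutting the curve at the points `cutPoint s (k + 1)`,
where the hyperplane `g k` cuts at the `k`-th point. -/
noncomputable def cutVec (g : BalancedSeq) (s : ℝ) (i : Fin 4) : EuclideanSpace ℝ (Fin 5) :=
  ‖rootVec (zeroPoint g i s)‖⁻¹ • rootVec (zeroPoint g i s)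

lemma norm_cutVec (g : BalancedSeq) (s : ℝ) (i : Fin 4) : ‖cutVec g s i‖ = 1 :=
  norm_smul_inv_norm (𝕜 := ℝ) (rootVec_ne_zero _)

lemma continuous_cutVec (g : BalancedSeq) : Continuous (cutVec g) := by
  refine continuous_pi fun i => ?_
  have h : Continuous fun s => rootVec (zeroPoint g i s) :=
    continuous_rootVec.comp <| continuous_pi fun j => by
      unfold zeroPoint cutPoint; fun_prop
  exact (h.norm.inv₀ fun s => norm_ne_zero_iff.2 (rootVec_ne_zero _)).smul h

lemma exists_trig_cutVec (g : BalancedSeq) (s : ℝ) (i : Fin 4) :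
    ∃ c > 0, ∀ t, trig (cutVec g s i) t =
      c * ∏ k with g.1 k = i, sin ((t - cutPoint s (k + 1)) / 2) := by
  refine ⟨‖rootVec (zeroPoint g i s)‖⁻¹,
    inv_pos.2 (norm_pos_iff.2 (rootVec_ne_zero _)), fun t => ?_⟩
  rw [cutVec, trig_smul, trig_rootVec]
  congr 1
  conv_rhs => rw [← Finset.image_orderEmbOfFin_univ _ (g.2 i)]
  rw [Finset.prod_image fun a _ b _ h => (Finset.orderEmbOfFin _ _).injective h]
  rfl

lemma trig_cutVec_eq_zero (g : BalancedSeq) (s : ℝ) (k : Fin 16) :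
    trig (cutVec g s (g.1 k)) (cutPoint s (k + 1)) = 0 := by
  obtain ⟨c, -, h⟩ := exists_trig_cutVec g s (g.1 k)
  rw [h, Finset.prod_eq_zero (i := k) (by simp) (by simp), mul_zero]

/-- The signs of the trigonometric polynomials on the arcs are given by the vertices of the
walk on the `4`-cube. -/
lemma boolSign_mul_trig_cutVec_pos (g : BalancedSeq) (s : ℝ) (m : Fin 16) (i : Fin 4) {t : ℝ}
    (ht : t ∈ Set.Ioo (cutPoint s m) (cutPoint s (m + 1))) :
    0 < boolSign (vertex g.1 m i) * trig (cutVec g s i) t := by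
  obtain ⟨c, hc, h⟩ := exists_trig_cutVec g s i
  have hs : boolSign (vertex g.1 m i) =
      ∏ k with g.1 k = i, (if k < m then (1 : ℝ) else -1) := by
    rw [Finset.prod_ite, Finset.prod_const_one, one_mul, Finset.prod_const]
    have hcard := Finset.card_filter_add_card_filter_not (s := {k | g.1 k = i}) (fun k => k < m)
    rw [g.2, Finset.filter_filter] at hcard
    rw [vertex, boolSign_decide_odd]
    refine neg_one_pow_congr ?_
    rw [Nat.even_iff, Nat.even_iff]
    omega
  rw [h, hs, mul_left_comm, ← Finset.prod_mul_distrib]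
  refine mul_pos hc (Finset.prod_pos fun k _ => ?_)
  have hk := cutPoint_succ_mem_Ioc s k
  have hm := (cutPoint_strictMono s).monotone (Nat.zero_le m)
  have hm' := (cutPoint_succ_mem_Ioc s m).2
  rw [cutPoint_zero] at hm
  split_ifs with hkm
  · have := (cutPoint_strictMono s).monotone (show (k : ℕ) + 1 ≤ m from hkm)
    rw [one_mul]
    exact sin_pos_of_pos_of_lt_pi (by linarith [ht.1]) (by linarith [ht.2, hk.1])
  · have := (cutPoint_strictMono s).monotone (show (m : ℕ) + 1 ≤ k + 1 by omega)
    have := sin_neg_of_neg_of_neg_pi_lt (x := (t - cutPoint s (k + 1)) / 2)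
      (by linarith [ht.2]) (by linarith [ht.1, hk.2])
    linarith

lemma vertex_zero (l : Fin 16 → Fin 4) (i : Fin 4) : vertex l 0 i = false := by
  simp [vertex]

lemma trig_cutVec_pos (g : BalancedSeq) (s : ℝ) (i : Fin 4) {t : ℝ}
    (ht : t ∈ Set.Ioo s (s + π / 8)) : 0 < trig (cutVec g s i) t := by
  have := boolSign_mul_trig_cutVec_pos g s 0 i (t := t) (by
    simpa [cutPoint_succ, cutPoint_zero] using ht)
  simpa [vertex_zero, boolSign] using this

/-- The vectors `cutVec g s i` are determined by their zeros and their sign on the first arc. -/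
lemma eq_cutVec {g : BalancedSeq} {s : ℝ} {i : Fin 4} {v : EuclideanSpace ℝ (Fin 5)}
    (hv : ‖v‖ = 1) (h0 : ∀ k, g.1 k = i → trig v (cutPoint s (k + 1)) = 0) {t : ℝ}
    (ht : t ∈ Set.Ioo s (s + π / 8)) (hpos : 0 < trig v t) : v = cutVec g s i := by
  classical
  refine eq_of_trig_eq_zero hv (norm_cutVec g s i) (a := s)
    (S := Finset.image (fun k : Fin 16 => cutPoint s ((k : ℕ) + 1)) {k | g.1 k = i}) (t := t)
    ?_ ?_ ⟨ht.1, by linarith [ht.2, pi_pos]⟩ ?_ ?_ hpos (trig_cutVec_pos g s i ht)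
  · rw [Finset.card_image_of_injective _ fun k k' h => ?_, g.2]
    have := (cutPoint_strictMono s).injective h
    omega
  all_goals
    intro x hx
    obtain ⟨k, hk, rfl⟩ := Finset.mem_image.1 hx
    simp only [mem_filter, mem_univ, true_and] at hk
  · exact cutPoint_succ_mem_Ioc s k
  · exact h0 k hk
  · rw [← hk]
    exact trig_cutVec_eq_zero g s k

lemma cutVec_periodic (g : BalancedSeq) : Function.Periodic (cutVec g) (2 * π) := by
  intro s
  funext i
  symm
  refine eq_cutVec (norm_cutVec g s i) (fun k hk => ?_) (t := s + π / 16 + 2 * π)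
    ⟨by linarith [pi_pos], by linarith [pi_pos]⟩ ?_
  · rw [← hk, show cutPoint (s + 2 * π) (k + 1) = cutPoint s (k + 1) + 2 * π by
      simp only [cutPoint]; ring, trig_periodic]
    exact trig_cutVec_eq_zero g s k
  · rw [trig_periodic]
    exact trig_cutVec_pos g s i ⟨by linarith [pi_pos], by linarith [pi_pos]⟩

lemma exists_mem_arc {s t : ℝ} (ht : t ∈ Set.Ico s (s + 2 * π)) :
    ∃ m : Fin 16, t = cutPoint s m ∨ t ∈ Set.Ioo (cutPoint s m) (cutPoint s (m + 1)) := by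
  have hpi := pi_pos
  have h0 : 0 ≤ (t - s) / (π / 8) := div_nonneg (by linarith [ht.1]) (by positivity)
  have hlt : (t - s) / (π / 8) < 16 := by
    rw [div_lt_iff₀ (by positivity)]
    linarith [ht.2]
  have h1 := Nat.floor_le h0
  have h2 := Nat.lt_floor_add_one ((t - s) / (π / 8))
  have h3 : ⌊(t - s) / (π / 8)⌋₊ < 16 := (Nat.floor_lt h0).2 (by exact_mod_cast hlt)
  generalize ⌊(t - s) / (π / 8)⌋₊ = m at *
  rw [le_div_iff₀ (by positivity)] at h1
  rw [div_lt_iff₀ (by positivity)] at h2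
  refine ⟨⟨m, h3⟩, ?_⟩
  have h4 : cutPoint s m ≤ t := by simp only [cutPoint]; linarith
  refine h4.eq_or_lt.imp Eq.symm fun h => ⟨h, ?_⟩
  rw [cutPoint_succ]
  simp only [cutPoint]
  linarith

lemma trig_cutVec_eq_zero_iff (g : BalancedSeq) (s : ℝ) (k : Fin 16) (i : Fin 4) :
    trig (cutVec g s i) (cutPoint s (k + 1)) = 0 ↔ g.1 k = i := by
  refine ⟨fun h => ?_, fun h => h ▸ trig_cutVec_eq_zero g s k⟩
  by_contra hki
  obtain ⟨c, hc, hp⟩ := exists_trig_cutVec g s i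
  rw [hp, mul_eq_zero, or_iff_right hc.ne', Finset.prod_eq_zero_iff] at h
  obtain ⟨k', hk', h⟩ := h
  simp only [mem_filter, mem_univ, true_and] at hk'
  have h1 := cutPoint_succ_mem_Ioc s k
  have h2 := cutPoint_succ_mem_Ioc s k'
  rw [sin_eq_zero_iff_of_lt_of_lt (by linarith [h1.1, h2.2]) (by linarith [h1.2, h2.1])] at h
  have := (cutPoint_strictMono s).injective (show cutPoint s (k + 1) = cutPoint s (k' + 1) by
    linarith)
  exact hki (by rw [show k = k' by omega, hk'])

lemma thetaMeasure_iInter (u : Fin 4 → EuclideanSpace ℝ (Fin 5)) (β : Fin 4 → Bool) (s : ℝ) :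
    thetaMeasure (⋂ i, sphereHalfspace (u i) (β i)) =
      volume ({t | ∀ i, 0 ≤ boolSign (β i) * trig (u i) t} ∩ Set.Ico s (s + 2 * π)) := by
  have hcurve : Continuous curve4 := by
    refine (PiLp.continuous_toLp 2 _).comp (continuous_pi fun i => ?_)
    fin_cases i <;> simp <;> fun_prop
  have hpair : ∀ v, Continuous (epair v) := by
    intro v
    unfold epair
    fun_prop
  have hset : ∀ v b, sphereHalfspace v b = {x | 0 ≤ boolSign b * epair v x} := by
    intro v b
    cases b <;> simp [sphereHalfspace, boolSign]
  have hpre : curve4 ⁻¹' (⋂ i, sphereHalfspace (u i) (β i)) =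
      {t | ∀ i, 0 ≤ boolSign (β i) * trig (u i) t} := by
    ext t
    simp [hset, trig]
  have hmeas : MeasurableSet (⋂ i, sphereHalfspace (u i) (β i)) := by
    refine MeasurableSet.iInter fun i => ?_
    rw [hset]
    exact (isClosed_le continuous_const (continuous_const.mul (hpair _))).measurableSet
  have hmeas' := hcurve.measurable hmeas
  have h2pi : (0 : ℝ) < 2 * π := by positivity
  rw [thetaMeasure, Measure.map_apply hcurve.measurable hmeas, Measure.restrict_apply hmeas']
  rw [hpre] at hmeas' ⊢
  have key := (isAddFundamentalDomain_Ioc h2pi 0 volume).measure_set_eq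
    (isAddFundamentalDomain_Ioc h2pi s volume)
    (A := {t | ∀ i, 0 ≤ boolSign (β i) * trig (u i) t}) hmeas' ?_
  · rw [zero_add] at key
    rw [measure_congr ((ae_eq_refl _).inter Ico_ae_eq_Ioc),
      measure_congr ((ae_eq_refl _).inter Ico_ae_eq_Ioc), key]
  · rintro ⟨c, hc⟩
    obtain ⟨n, rfl⟩ := AddSubgroup.mem_zmultiples_iff.1 hc
    ext t
    have : ∀ v, trig v (n * (2 * π) + t) = trig v t := fun v => by
      rw [add_comm]
      exact (trig_periodic v).int_mul n t
    simp [AddSubgroup.vadd_def, this]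

lemma vertex_bijective {l : Fin 16 → Fin 4} (hl : Function.Injective (vertex l)) :
    Function.Bijective (vertex l) :=
  (Fintype.bijective_iff_injective_and_card _).2 ⟨hl, by simp⟩

lemma cutVec_mem_solutionSet {g : BalancedSeq} (hg : Function.Injective (vertex g.1)) (s : ℝ) :
    cutVec g s ∈ SolutionSet := by
  have hdist : ∀ i j (c : ℝ), i ≠ j → cutVec g s i ≠ c • cutVec g s j := by
    intro i j c hij h
    obtain ⟨k, hk⟩ := surjective_of_card_fiber g.2 j
    have h0 : trig (cutVec g s i) (cutPoint s (k + 1)) = 0 := by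
      rw [h, trig_smul, ← hk, trig_cutVec_eq_zero, mul_zero]
    exact hij (((trig_cutVec_eq_zero_iff g s k i).1 h0).symm.trans hk)
  refine ⟨norm_cutVec g s, fun i j hij => ⟨?_, ?_⟩, fun β => ?_⟩
  · simpa using hdist i j 1 hij
  · simpa using hdist i j (-1) hij
  obtain ⟨m, rfl⟩ := (vertex_bijective hg).2 β
  have hvol : volume (Set.Ioo (cutPoint s m) (cutPoint s (m + 1))) =
      ENNReal.ofReal (2 * π / 16) := by
    rw [Real.volume_Ioo, cutPoint_succ]
    congr 1
    ring
  rw [thetaMeasure_iInter _ _ s, ← hvol]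
  apply le_antisymm
  · have hsub : {t | ∀ i, 0 ≤ boolSign (vertex g.1 m i) * trig (cutVec g s i) t} ∩
        Set.Ico s (s + 2 * π) ⊆ Set.Ioo (cutPoint s m) (cutPoint s (m + 1)) ∪
          Set.range (cutPoint s) := by
      rintro t ⟨ht, htI⟩
      obtain ⟨m', rfl | hm'⟩ := exists_mem_arc htI
      · exact Or.inr ⟨m', rfl⟩
      · have : m' = m := by
          apply hg
          funext i
          have h1 := ht i
          have h2 := boolSign_mul_trig_cutVec_pos g s m' i hm'
          revert h1 h2
          cases vertex g.1 m i <;> cases vertex g.1 m' i <;> simp [boolSign]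
        exact Or.inl (this ▸ hm')
    refine (measure_mono hsub).trans ((measure_union_le _ _).trans ?_)
    rw [(Set.countable_range _).measure_zero, add_zero]
  · refine measure_mono fun t ht => ⟨fun i =>
      (boolSign_mul_trig_cutVec_pos g s m i ht).le, ?_⟩
    have h1 := (cutPoint_strictMono s).monotone (Nat.zero_le m)
    have h2 := (cutPoint_succ_mem_Ioc s m).2
    rw [cutPoint_zero] at h1
    exact ⟨by linarith [ht.1], by linarith [ht.2]⟩

lemma ne_zero_of_mem_solutionSet {u : Fin 4 → EuclideanSpace ℝ (Fin 5)} (hu : u ∈ SolutionSet)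
    (i : Fin 4) : u i ≠ 0 := by
  rw [← norm_ne_zero_iff, hu.1 i]
  exact one_ne_zero

lemma volume_signs_of_mem_solutionSet {u : Fin 4 → EuclideanSpace ℝ (Fin 5)}
    (hu : u ∈ SolutionSet) (β : Fin 4 → Bool) (s : ℝ) :
    volume ({t | ∀ i, 0 ≤ boolSign (β i) * trig (u i) t} ∩ Set.Ico s (s + 2 * π)) =
      ENNReal.ofReal (2 * π / 16) := by
  rw [← thetaMeasure_iInter]
  exact hu.2.2 β

lemma finite_trig_eq_zero {u : EuclideanSpace ℝ (Fin 5)} (hu : u ≠ 0) :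
    ({t | trig u t = 0} ∩ Set.Ico 0 (2 * π)).Finite := by
  by_contra h
  obtain ⟨S, hS, hcard⟩ := Set.Infinite.exists_subset_card_eq h 5
  have := card_le_four_of_trig_eq_zero hu (S := S)
    (fun x hx y hy => by linarith [(hS hx).2.2, (hS hy).2.1]) fun t ht => (hS ht).1
  omega

/-- Some point of the curve lies strictly on the positive side of all four hyperplanes. -/
lemma exists_trig_pos {u : Fin 4 → EuclideanSpace ℝ (Fin 5)} (hu : u ∈ SolutionSet) :
    ∃ t, ∀ i, 0 < trig (u i) t := by
  have hvol := volume_signs_of_mem_solutionSet hu (fun _ => false) 0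
  have hfin := Set.finite_iUnion fun i => finite_trig_eq_zero (ne_zero_of_mem_solutionSet hu i)
  by_contra! h
  have hsub : {t | ∀ i, 0 ≤ boolSign false * trig (u i) t} ∩ Set.Ico 0 (0 + 2 * π) ⊆
      ⋃ i, {t | trig (u i) t = 0} ∩ Set.Ico 0 (2 * π) := by
    rintro t ⟨ht, htI⟩
    obtain ⟨i, hi⟩ := h t
    refine Set.mem_iUnion.2 ⟨i, le_antisymm hi ?_, by simpa using htI⟩
    simpa [boolSign] using ht i
  have h0 := measure_mono_null hsub (hfin.measure_zero volume)
  rw [h0] at hvol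
  have : 0 < ENNReal.ofReal (2 * π / 16) := ENNReal.ofReal_pos.2 (by positivity)
  exact this.ne hvol

/-- A function continuous and nonvanishing on an interval has constant sign there. -/
lemma exists_boolSign_mul_pos {f : ℝ → ℝ} (hf : Continuous f) {a b : ℝ}
    (h : ∀ t ∈ Set.Ioo a b, f t ≠ 0) : ∃ β, ∀ t ∈ Set.Ioo a b, 0 < boolSign β * f t := by
  by_cases hpos : ∀ t ∈ Set.Ioo a b, 0 < f t
  · exact ⟨false, fun t ht => by simpa [boolSign] using hpos t ht⟩
  · push Not at hpos
    obtain ⟨x, hx, hfx⟩ := hpos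
    refine ⟨true, fun t ht => ?_⟩
    simp only [boolSign, if_true, neg_mul, one_mul, Left.neg_pos_iff]
    by_contra! hft
    obtain ⟨y, hy, hfy⟩ := isPreconnected_Ioo.intermediate_value hx ht hf.continuousOn ⟨hfx, hft⟩
    exact h y hy hfy

/-- The cutting points are at most `π / 8` apart. -/
lemma sub_le_of_trig_ne_zero {u : Fin 4 → EuclideanSpace ℝ (Fin 5)} (hu : u ∈ SolutionSet)
    {a b : ℝ} (h : ∀ t ∈ Set.Ioo a b, ∀ i, trig (u i) t ≠ 0) : b - a ≤ π / 8 := by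
  have hpi := pi_pos
  choose β hβ using fun i => exists_boolSign_mul_pos (continuous_trig (u i))
    fun t ht => h t ht i
  have hsub : Set.Ioo a (min b (a + 2 * π)) ⊆
      {t | ∀ i, 0 ≤ boolSign (β i) * trig (u i) t} ∩ Set.Ico a (a + 2 * π) := fun t ht =>
    ⟨fun i => (hβ i t ⟨ht.1, ht.2.trans_le (min_le_left _ _)⟩).le, ht.1.le,
      ht.2.trans_le (min_le_right _ _)⟩
  have h1 := measure_mono (μ := volume) hsub
  rw [volume_signs_of_mem_solutionSet hu, Real.volume_Ioo,
    ENNReal.ofReal_le_ofReal_iff (by positivity)] at h1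
  rcases min_cases b (a + 2 * π) with ⟨h2, -⟩ | ⟨h2, -⟩ <;> rw [h2] at h1 <;> linarith

/-- The parameters at which the curve meets one of the hyperplanes. -/
def cutSet (u : Fin 4 → EuclideanSpace ℝ (Fin 5)) : Set ℝ := {t | ∃ i, trig (u i) t = 0}

lemma isClosed_cutSet (u : Fin 4 → EuclideanSpace ℝ (Fin 5)) : IsClosed (cutSet u) := by
  have : cutSet u = ⋃ i, {t | trig (u i) t = 0} := by
    ext t; simp [cutSet]
  rw [this]
  exact isClosed_iUnion_of_finite fun i => isClosed_eq (continuous_trig _) continuous_const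

lemma exists_mem_cutSet_Ioc {u : Fin 4 → EuclideanSpace ℝ (Fin 5)} (hu : u ∈ SolutionSet)
    (z : ℝ) : ∃ z' ∈ cutSet u, z' ∈ Set.Ioc z (z + π / 8) := by
  have hpi := pi_pos
  by_contra! h
  have hz : z + π / 8 ∈ (cutSet u)ᶜ := fun hz => h _ hz ⟨by linarith, le_rfl⟩
  obtain ⟨ε, hε, hball⟩ := Metric.isOpen_iff.1 (isClosed_cutSet u).isOpen_compl _ hz
  have := sub_le_of_trig_ne_zero hu (a := z) (b := z + π / 8 + ε) fun t ht i hi => by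
    rcases le_or_gt t (z + π / 8) with h1 | h1
    · exact h t ⟨i, hi⟩ ⟨ht.1, h1⟩
    · refine hball ?_ ⟨i, hi⟩
      rw [Metric.mem_ball, Real.dist_eq, abs_lt]
      constructor <;> linarith [ht.2]
  linarith

/-- The cutting points are equally spaced. -/
lemma add_mem_cutSet {u : Fin 4 → EuclideanSpace ℝ (Fin 5)} (hu : u ∈ SolutionSet)
    {z : ℝ} (hz : z ∈ cutSet u) : z + π / 8 ∈ cutSet u := by
  classical
  choose next hnext hmem using exists_mem_cutSet_Ioc hu
  have hiter : ∀ n, next^[n] z ∈ cutSet u := by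
    intro n
    cases n with
    | zero => exact hz
    | succ n => rw [Function.iterate_succ_apply']; exact hnext _
  have hmono : StrictMono fun n => next^[n] z := strictMono_nat_of_lt_succ fun n => by
    rw [Function.iterate_succ_apply']; exact (hmem _).1
  have hle : ∀ n, next^[n] (next z) ≤ next z + n * (π / 8) := by
    intro n
    induction n with
    | zero => simp
    | succ n ih =>
      rw [Function.iterate_succ_apply']
      push_cast
      linarith [(hmem (next^[n] (next z))).2]
  have hfar : z + 2 * π ≤ next^[16] z := by
    by_contra! hlt
    have hS : (range 17).image (fun n => next^[n] z) ⊆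
        univ.biUnion fun i => {t ∈ (range 17).image (fun n => next^[n] z) | trig (u i) t = 0} := by
      intro t ht
      obtain ⟨n, -, hn⟩ := Finset.mem_image.1 ht
      obtain ⟨i, hi⟩ := hiter n
      refine Finset.mem_biUnion.2 ⟨i, mem_univ _, Finset.mem_filter.2 ⟨ht, ?_⟩⟩
      rw [← hn, hi]
    have hrange : ∀ t ∈ (range 17).image (fun n => next^[n] z), z ≤ t ∧ t < z + 2 * π := by
      intro t ht
      obtain ⟨n, hn, rfl⟩ := Finset.mem_image.1 ht
      have hn' : n ≤ 16 := by rw [Finset.mem_range] at hn; omega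
      exact ⟨hmono.monotone (Nat.zero_le n), (hmono.monotone hn').trans_lt hlt⟩
    have hcard := (Finset.card_le_card hS).trans (Finset.card_biUnion_le_card_mul _ _ 4 fun i _ =>
      card_le_four_of_trig_eq_zero (ne_zero_of_mem_solutionSet hu i)
        (fun x hx y hy => by
          linarith [(hrange x (Finset.mem_filter.1 hx).1).2,
            (hrange y (Finset.mem_filter.1 hy).1).1])
        fun t ht => (Finset.mem_filter.1 ht).2)
    rw [Finset.card_image_of_injective _ hmono.injective] at hcard
    simp at hcard
  have h15 := hle 15
  rw [← Function.iterate_succ_apply] at h15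
  have : next z = z + π / 8 := by
    refine le_antisymm (hmem z).2 ?_
    push_cast at h15
    linarith
  exact this ▸ hnext z

lemma cutPoint_mem_cutSet {u : Fin 4 → EuclideanSpace ℝ (Fin 5)} (hu : u ∈ SolutionSet)
    {z : ℝ} (hz : z ∈ cutSet u) (n : ℕ) : cutPoint z n ∈ cutSet u := by
  induction n with
  | zero => rwa [cutPoint_zero]
  | succ n ih => rw [cutPoint_succ]; exact add_mem_cutSet hu ih

lemma exists_mem_cutSet_Ioo {u : Fin 4 → EuclideanSpace ℝ (Fin 5)} (hu : u ∈ SolutionSet) {t : ℝ}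
    (ht : t ∉ cutSet u) : ∃ s ∈ cutSet u, t ∈ Set.Ioo s (s + π / 8) := by
  have hpi := pi_pos
  obtain ⟨z, hz, hzt⟩ := exists_mem_cutSet_Ioc hu (t - π / 8)
  rw [sub_add_cancel] at hzt
  refine ⟨z, hz, hzt.2.lt_of_ne ?_, by linarith [hzt.1]⟩
  rintro rfl
  exact ht hz

/-- Distinct arcs of a solution lie in distinct orthants. -/
lemma vertex_injective_of_mem_solutionSet {g : BalancedSeq} {s : ℝ}
    (hu : cutVec g s ∈ SolutionSet) : Function.Injective (vertex g.1) := by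
  have hpi := pi_pos
  have hmono := cutPoint_strictMono s
  refine .of_lt_imp_ne fun m m' hlt h => ?_
  have hsub : Set.Ioo (cutPoint s m) (cutPoint s (m + 1)) ∪
      Set.Ioo (cutPoint s m') (cutPoint s (m' + 1)) ⊆
      {t | ∀ i, 0 ≤ boolSign (vertex g.1 m i) * trig (cutVec g s i) t} ∩
        Set.Ico s (s + 2 * π) := by
    have key : ∀ n : Fin 16, vertex g.1 m = vertex g.1 n →
        Set.Ioo (cutPoint s n) (cutPoint s (n + 1)) ⊆
        {t | ∀ i, 0 ≤ boolSign (vertex g.1 m i) * trig (cutVec g s i) t} ∩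
          Set.Ico s (s + 2 * π) := by
      intro n hn t ht
      refine ⟨fun i => ?_, ?_⟩
      · rw [hn]
        exact (boolSign_mul_trig_cutVec_pos g s n i ht).le
      · have h1 := hmono.monotone (Nat.zero_le n)
        rw [cutPoint_zero] at h1
        exact ⟨by linarith [ht.1], by linarith [ht.2, (cutPoint_succ_mem_Ioc s n).2]⟩
    exact Set.union_subset (key m rfl) (key m' h)
  have hdisj : Disjoint (Set.Ioo (cutPoint s m) (cutPoint s (m + 1)))
      (Set.Ioo (cutPoint s m') (cutPoint s (m' + 1))) :=
    Set.disjoint_left.2 fun t ht ht' => by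
      have := hmono.monotone (show (m : ℕ) + 1 ≤ m' from hlt)
      linarith [ht.2, ht'.1]
  have h1 := measure_mono (μ := volume) hsub
  rw [volume_signs_of_mem_solutionSet hu, measure_union hdisj measurableSet_Ioo,
    Real.volume_Ioo, Real.volume_Ioo, cutPoint_succ, cutPoint_succ, add_sub_cancel_left,
    add_sub_cancel_left, ← ENNReal.ofReal_add (by positivity) (by positivity),
    ENNReal.ofReal_le_ofReal_iff (by positivity)] at h1
  linarith

lemma exists_eq_cutVec {u : Fin 4 → EuclideanSpace ℝ (Fin 5)} (hu : u ∈ SolutionSet) :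
    ∃ g : BalancedSeq, Function.Injective (vertex g.1) ∧ ∃ s, u = cutVec g s := by
  classical
  obtain ⟨t, ht⟩ := exists_trig_pos hu
  obtain ⟨s, hs, hst⟩ := exists_mem_cutSet_Ioo hu (t := t) fun ⟨i, hi⟩ => (ht i).ne' hi
  choose l hl using fun k : Fin 16 => cutPoint_mem_cutSet hu hs (k + 1)
  have hle : ∀ i, #{k | l k = i} ≤ 4 := by
    intro i
    have hinj : Function.Injective fun k : Fin 16 => cutPoint s ((k : ℕ) + 1) := fun k k' h => by
      have := (cutPoint_strictMono s).injective h
      omega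
    rw [← Finset.card_image_of_injective _ hinj]
    refine card_le_four_of_trig_eq_zero (ne_zero_of_mem_solutionSet hu i) ?_ ?_
    · intro x hx y hy
      obtain ⟨k, -, rfl⟩ := Finset.mem_image.1 hx
      obtain ⟨k', -, rfl⟩ := Finset.mem_image.1 hy
      linarith [(cutPoint_succ_mem_Ioc s k).2, (cutPoint_succ_mem_Ioc s k').1]
    · intro x hx
      obtain ⟨k, hk, rfl⟩ := Finset.mem_image.1 hx
      rw [← (Finset.mem_filter.1 hk).2]
      exact hl k
  have hsum : ∑ i, #{k | l k = i} = ∑ _i : Fin 4, 4 := by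
    rw [← Finset.card_eq_sum_card_fiberwise fun k _ => mem_univ _]
    simp
  have hcard : ∀ i, #{k | l k = i} = 4 := fun i =>
    (Finset.sum_eq_sum_iff_of_le fun i _ => hle i).1 hsum i (mem_univ i)
  have hu' : u = cutVec ⟨l, hcard⟩ s := by
    funext i
    exact eq_cutVec (hu.1 i) (fun k hk => hk ▸ hl k) hst (ht i)
  refine ⟨⟨l, hcard⟩, ?_, s, hu'⟩
  subst hu'
  exact vertex_injective_of_mem_solutionSet hu

lemma cutVec_eq_iff {g g' : BalancedSeq} (hg : Function.Injective (vertex g.1)) {s s' : ℝ} :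
    cutVec g s = cutVec g' s' ↔ g = g' ∧ (s : AddCircle (2 * π)) = s' := by
  have hpi := pi_pos
  constructor
  · intro h
    obtain ⟨n, hn, -⟩ := existsUnique_add_zsmul_mem_Ico (show (0 : ℝ) < 2 * π by positivity) s' s
    have hper : cutVec g' (s' + n • (2 * π)) = cutVec g' s' := (cutVec_periodic g').zsmul n s'
    have hcoe : ((s' + n • (2 * π) : ℝ) : AddCircle (2 * π)) = s' := by
      rw [AddCircle.coe_add, AddCircle.coe_zsmul, AddCircle.coe_period, smul_zero, add_zero]
    rw [← hcoe]
    rw [← hper] at h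
    generalize s' + n • (2 * π) = t at *
    have hpos : ∀ i, 0 < trig (cutVec g s i) (t + π / 16) := fun i => by
      rw [h]
      exact trig_cutVec_pos g' t i ⟨by linarith, by linarith⟩
    have hzero : trig (cutVec g s (g'.1 15)) t = 0 := by
      rw [h, ← trig_periodic]
      simpa [← cutPoint_sixteen] using trig_cutVec_eq_zero g' t 15
    obtain ⟨m, hm | hm⟩ := exists_mem_arc hn
    · have hm0 : m = 0 := by
        refine hg (funext fun i => ?_)
        have h1 := boolSign_mul_trig_cutVec_pos g s m i (t := t + π / 16)
          ⟨by linarith, by rw [cutPoint_succ]; linarith⟩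
        rw [vertex_zero]
        by_contra hv
        rw [Bool.not_eq_false] at hv
        simp only [hv, boolSign, if_true] at h1
        linarith [hpos i]
      obtain rfl : t = s := by simpa [hm0, cutPoint_zero] using hm
      refine ⟨Subtype.ext (funext fun k => ?_), rfl⟩
      rw [← trig_cutVec_eq_zero_iff g t k, h]
      exact trig_cutVec_eq_zero g' t k
    · have := boolSign_mul_trig_cutVec_pos g s m (g'.1 15) hm
      rw [hzero, mul_zero] at this
      exact absurd this (lt_irrefl 0)
  · rintro ⟨rfl, h⟩
    have := congrArg (cutVec_periodic g).lift h
    simpa using this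

/-- Rotating and relabelling the label sequence amounts to acting by an element of `W₄`. -/
lemma actW_cutVec {g g' : BalancedSeq} {σ : Equiv.Perm (Fin 4)} {k : Fin 16}
    (h : g'.1 = fun j => σ (g.1 (j + k))) (s : ℝ) :
    actW (fun i => vertex g.1 k (σ⁻¹ i)) σ (cutVec g s) = cutVec g' (cutPoint s k) := by
  have hpi := pi_pos
  funext i
  change boolSign _ • cutVec g s (σ⁻¹ i) = _
  refine eq_cutVec ?_ (fun j hj => ?_) (t := cutPoint s k + π / 16)
    ⟨by linarith, by linarith⟩ ?_
  · rw [norm_smul, norm_cutVec, mul_one]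
    rw [Real.norm_eq_abs, abs_boolSign]
  · have hj' : σ⁻¹ i = g.1 (j + k) := by
      rw [← hj, h]
      exact σ.symm_apply_apply _
    have hz : trig (cutVec g s (σ⁻¹ i)) (cutPoint (cutPoint s k) (j + 1)) = 0 := by
      have h0 := trig_cutVec_eq_zero g s (j + k)
      rw [← hj'] at h0
      rcases lt_or_ge ((j : ℕ) + k) 16 with hlt | hge
      · rw [Fin.val_add_eq_of_add_lt hlt] at h0
        rw [← h0]
        congr 1
        simp only [cutPoint]
        push_cast
        ring
      · have hval : ((j + k : Fin 16) : ℕ) + 16 = j + k := by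
          rw [Fin.val_add]; omega
        rw [← trig_periodic] at h0
        rw [← h0]
        congr 1
        have hval' : (((j + k : Fin 16) : ℕ) : ℝ) + 16 = j + k := by exact_mod_cast hval
        simp only [cutPoint]
        push_cast
        linear_combination (-π / 8) * hval'
    rw [trig_smul, hz, mul_zero]
  · rw [trig_smul]
    exact boolSign_mul_trig_cutVec_pos g s k _
      ⟨by linarith, by rw [cutPoint_succ]; linarith⟩

/-- The connected components of a Hausdorff space that is the disjoint union of finitely many
images of a compact connected space. -/
lemma connectedComponent_eq_range {G C X : Type*} [Finite G] [TopologicalSpace C]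
    [TopologicalSpace X] [T2Space X] [CompactSpace C] [ConnectedSpace C] {F : G → C → X}
    (hF : ∀ g, Continuous (F g)) (hbij : Function.Bijective fun p : G × C => F p.1 p.2)
    (g : G) (c : C) : connectedComponent (F g c) = Set.range (F g) := by
  have hclosed : ∀ g, IsClosed (Set.range (F g)) := fun g => (isCompact_range (hF g)).isClosed
  refine subset_antisymm ?_
    ((isPreconnected_range (hF g)).subset_connectedComponent ⟨c, rfl⟩)
  refine IsClopen.connectedComponent_subset ⟨hclosed g, ?_⟩ ⟨c, rfl⟩
  have hcompl : Set.range (F g) = (⋃ g' : {g' // g' ≠ g}, Set.range (F g'))ᶜ := by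
    ext x
    obtain ⟨⟨g₀, c₀⟩, rfl⟩ := hbij.2 x
    simp only [Set.mem_range, Set.mem_compl_iff, Set.mem_iUnion, Subtype.exists, not_exists]
    constructor
    · rintro ⟨c₁, h₁⟩ g' hg' c₂ h₂
      exact hg' (congrArg Prod.fst (@hbij.1 (g', c₂) (g, c₁) (h₂.trans h₁.symm)))
    · intro h
      by_contra! hne
      by_cases hg : g₀ = g
      · exact hne c₀ (by rw [hg])
      · exact h g₀ hg c₀ rfl
  rw [hcompl]
  exact (isClosed_iUnion_of_finite fun g' : {g' // g' ≠ g} => hclosed g').isOpen_compl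

lemma card_connectedComponents {G C X : Type*} [Finite G] [TopologicalSpace C]
    [TopologicalSpace X] [T2Space X] [CompactSpace C] [ConnectedSpace C] {F : G → C → X}
    (hF : ∀ g, Continuous (F g)) (hbij : Function.Bijective fun p : G × C => F p.1 p.2) :
    Nat.card (ConnectedComponents X) = Nat.card G := by
  obtain ⟨c⟩ := (inferInstance : Nonempty C)
  refine (Nat.card_eq_of_bijective (fun g => (F g c : ConnectedComponents X)) ⟨?_, ?_⟩).symm
  · intro g g' h
    have h' : F g c ∈ Set.range (F g') := by
      rw [← connectedComponent_eq_range hF hbij g' c]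
      exact ConnectedComponents.coe_eq_coe'.1 h
    obtain ⟨c', hc'⟩ := h'
    exact congrArg Prod.fst (@hbij.1 (g, c) (g', c') hc'.symm)
  · intro x
    obtain ⟨x, rfl⟩ := ConnectedComponents.surjective_coe x
    obtain ⟨⟨g, c'⟩, rfl⟩ := hbij.2 x
    refine ⟨g, ConnectedComponents.coe_eq_coe.2 ?_⟩
    rw [connectedComponent_eq_range hF hbij, connectedComponent_eq_range hF hbij]

instance : Fact ((0 : ℝ) < 2 * π) := ⟨by positivity⟩

/-- The circle of solutions with a given label sequence. -/
noncomputable def solutionCircle (l : {l // IsBalancedGray l}) (c : AddCircle (2 * π)) :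
    ↥SolutionSet :=
  ⟨(cutVec_periodic ⟨l.1, l.2.card_fiber⟩).lift c, by
    induction c using QuotientAddGroup.induction_on with
    | H s => exact cutVec_mem_solutionSet l.2.injective s⟩

lemma continuous_solutionCircle (l : {l // IsBalancedGray l}) : Continuous (solutionCircle l) :=
  ((continuous_cutVec ⟨l.1, l.2.card_fiber⟩).quotient_lift _).subtype_mk _

lemma bijective_solutionCircle :
    Function.Bijective fun p : {l // IsBalancedGray l} × AddCircle (2 * π) =>
      solutionCircle p.1 p.2 := by
  constructor
  · rintro ⟨l, c⟩ ⟨l', c'⟩ h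
    induction c using QuotientAddGroup.induction_on with | H s => ?_
    induction c' using QuotientAddGroup.induction_on with | H s' => ?_
    obtain ⟨h1, h2⟩ := (cutVec_eq_iff (g := ⟨l.1, l.2.card_fiber⟩)
      (g' := ⟨l'.1, l'.2.card_fiber⟩) l.2.injective).1 (congrArg Subtype.val h)
    exact Prod.ext (Subtype.ext (Subtype.mk.inj h1)) h2
  · rintro ⟨u, hu⟩
    obtain ⟨g, hg, s, rfl⟩ := exists_eq_cutVec hu
    exact ⟨(⟨g.1, g.2, hg⟩, s), rfl⟩

/-- The solution set `Σ_θ` has exactly `|W₄| = 2⁴·4! = 384` connected components, each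
homeomorphic to the circle, and the `W₄`-action permutes these components transitively. -/
theorem solution_set_structure :
    Nat.card (ConnectedComponents ↥SolutionSet) = 384 ∧
    (∀ x : ↥SolutionSet, Nonempty (↥(connectedComponent x) ≃ₜ Circle)) ∧
    (∀ x y : ↥SolutionSet, ∃ (ε : Fin 4 → Bool) (σ : Equiv.Perm (Fin 4))
      (h : actW ε σ x.val ∈ SolutionSet),
        (⟨actW ε σ x.val, h⟩ : ↥SolutionSet) ∈ connectedComponent y) := by
  have hcard := card_isBalancedGray
  have : Finite {l // IsBalancedGray l} := Nat.finite_of_card_ne_zero (by rw [hcard]; norm_num)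
  have hF := continuous_solutionCircle
  have hbij := bijective_solutionCircle
  refine ⟨(card_connectedComponents hF hbij).trans hcard, fun x => ?_, fun x y => ?_⟩
  · obtain ⟨⟨l, c⟩, rfl⟩ := hbij.2 x
    have hinj : Function.Injective (solutionCircle l) := fun c c' h =>
      congrArg Prod.snd (@hbij.1 (l, c) (l, c') h)
    exact ⟨(Homeomorph.setCongr (connectedComponent_eq_range hF hbij l c)).trans <|
      ((hF l).isClosedEmbedding hinj).isEmbedding.toHomeomorph.symm.trans
        AddCircle.homeomorphCircle'⟩
  · obtain ⟨⟨l, c⟩, rfl⟩ := hbij.2 x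
    obtain ⟨⟨l', c'⟩, rfl⟩ := hbij.2 y
    induction c using QuotientAddGroup.induction_on with | H s => ?_
    obtain ⟨σ, k, h⟩ := l.2.exists_eq l'.2
    have hact := actW_cutVec (g := ⟨l.1, l.2.card_fiber⟩) (g' := ⟨l'.1, l'.2.card_fiber⟩) h s
    refine ⟨fun i => vertex l.1 k (σ⁻¹ i), σ, ?_, ?_⟩
    · exact hact ▸ cutVec_mem_solutionSet l'.2.injective _
    · rw [connectedComponent_eq_range hF hbij]
      exact ⟨(cutPoint s k : ℝ), Subtype.ext hact.symm⟩
end
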